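/- arXiv:1208.6280 — 3 statements merged into one kernel-verified Lean document; each statement's English description precedes it below -/
import Mathlib

section
/- (Convergence of the regular nilpotent orbital integral) For every smooth compactly supported function f : M_{n+1}(F) → ℂ and every s ∈ ℂ with Re(s) > 1 − 1/n, the function GL_n(F) → ℂ, h ↦ f(h·ξ_+)·η(det h)·‖det h‖^s (where ‖det h‖^s := exp(s·log‖det h‖)), is absolutely μ-integrable; i.e., the orbital integral O(ξ_+, f, s) := ∫_{GL_n(F)} f(h·ξ_+)·η(det h)·‖det h‖^s dμ(h) converges absolutely. -/
open Matrix MeasureTheory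

namespace ZhangRTF

variable {F : Type*} [Field F] {n : ℕ}

/-- Block diagonal embedding `diag(h,1) ∈ M_{n+1}(F)` of `h ∈ M_n(F)`. -/
def emb (h : Matrix (Fin n) (Fin n) F) : Matrix (Fin (n + 1)) (Fin (n + 1)) F :=
  Matrix.of fun i j =>
    if hi : (i : ℕ) < n then
      (if hj : (j : ℕ) < n then h ⟨i, hi⟩ ⟨j, hj⟩ else 0)
    else (if (j : ℕ) < n then 0 else 1)

/-- Conjugation action of `GL_n(F)` on `M_{n+1}(F)`: `h·X = diag(h,1) X diag(h,1)⁻¹`. -/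
def act (h : Matrix.GeneralLinearGroup (Fin n) F)
    (X : Matrix (Fin (n + 1)) (Fin (n + 1)) F) : Matrix (Fin (n + 1)) (Fin (n + 1)) F :=
  emb (h : Matrix (Fin n) (Fin n) F) * X *
    emb ((h⁻¹ : Matrix.GeneralLinearGroup (Fin n) F) : Matrix (Fin n) (Fin n) F)

/-- The upper-left `n × n` block `A` of `X = [[A,u],[v,w]]`. -/
def blockA (X : Matrix (Fin (n + 1)) (Fin (n + 1)) F) : Matrix (Fin n) (Fin n) F :=
  Matrix.of fun i j => X i.castSucc j.castSucc

/-- The upper-right column `u` of `X = [[A,u],[v,w]]`. -/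
def blockU (X : Matrix (Fin (n + 1)) (Fin (n + 1)) F) : Fin n → F :=
  fun i => X i.castSucc (Fin.last n)

/-- The lower-left row `v` of `X = [[A,u],[v,w]]`. -/
def blockV (X : Matrix (Fin (n + 1)) (Fin (n + 1)) F) : Fin n → F :=
  fun j => X (Fin.last n) j.castSucc

/-- The lower-right corner `w` of `X = [[A,u],[v,w]]`. -/
def blockW (X : Matrix (Fin (n + 1)) (Fin (n + 1)) F) : F :=
  X (Fin.last n) (Fin.last n)

/-- `δ₊(X)`: the matrix whose `j`-th column is `A^{n-j} u` (`1 ≤ j ≤ n`, 1-indexed). -/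
def deltaPlus (X : Matrix (Fin (n + 1)) (Fin (n + 1)) F) : Matrix (Fin n) (Fin n) F :=
  Matrix.of fun i j => (blockA X ^ (n - 1 - (j : ℕ)) *ᵥ blockU X) i

/-- `δ₋(X)`: the matrix whose `i`-th row is `v A^{i-1}` (`1 ≤ i ≤ n`, 1-indexed). -/
def deltaMinus (X : Matrix (Fin (n + 1)) (Fin (n + 1)) F) : Matrix (Fin n) (Fin n) F :=
  Matrix.of fun i j => (blockV X ᵥ* blockA X ^ (i : ℕ)) j

/-- `Δ₊(X) = det δ₊(X)`. -/
def DeltaPlus (X : Matrix (Fin (n + 1)) (Fin (n + 1)) F) : F := (deltaPlus X).det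

/-- `Δ₋(X) = det δ₋(X)`. -/
def DeltaMinus (X : Matrix (Fin (n + 1)) (Fin (n + 1)) F) : F := (deltaMinus X).det

/-- The `a`-invariants: `a_i = -(coefficient of T^{n-i} in charpoly A)` (1-indexed). -/
noncomputable def aInv (X : Matrix (Fin (n + 1)) (Fin (n + 1)) F) : Fin n → F :=
  fun i => -((blockA X).charpoly.coeff (n - 1 - (i : ℕ)))

/-- The `b`-invariants: `b_0 = w` and `b_j = v A^{j-1} u` for `1 ≤ j ≤ n`. -/
def bInv (X : Matrix (Fin (n + 1)) (Fin (n + 1)) F) : Fin (n + 1) → F :=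
  fun j => if (j : ℕ) = 0 then blockW X
    else blockV X ⬝ᵥ (blockA X ^ ((j : ℕ) - 1) *ᵥ blockU X)

/-- The invariants map `π : M_{n+1}(F) → F^n × F^{n+1}`. -/
noncomputable def invMap (X : Matrix (Fin (n + 1)) (Fin (n + 1)) F) : (Fin n → F) × (Fin (n + 1) → F) :=
  (aInv X, bInv X)

/-- The regular nilpotent `ξ₊`: `(i,i+1)`-entries equal to `1`, all others `0`. -/
def xiPlus (n : ℕ) : Matrix (Fin (n + 1)) (Fin (n + 1)) F :=
  Matrix.of fun i j => if (j : ℕ) = (i : ℕ) + 1 then 1 else 0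

/-- The section `σ(a,b)` of the invariants map. -/
def sectSigma (a : Fin n → F) (b : Fin (n + 1) → F) : Matrix (Fin (n + 1)) (Fin (n + 1)) F :=
  Matrix.of fun i j =>
    if hi : (i : ℕ) < n then
      (if (j : ℕ) = 0 then a ⟨i, hi⟩ else 0) + (if (j : ℕ) = (i : ℕ) + 1 then 1 else 0)
    else b j.rev

/-- The variant section `σ'(a,b)`. -/
def sectSigma' (a : Fin n → F) (b : Fin (n + 1) → F) : Matrix (Fin (n + 1)) (Fin (n + 1)) F :=
  Matrix.of fun i j =>
    if (i : ℕ) < n - 1 then (if (j : ℕ) = (i : ℕ) + 1 then 1 else 0)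
    else if (i : ℕ) = n - 1 then
      (if hj : (j : ℕ) < n then a ⟨n - 1 - (j : ℕ), by omega⟩ else 1)
    else b j.rev

/-- Membership in `N_{n,-}`: lower triangular with unit diagonal. -/
def IsLowerUni (h : Matrix (Fin n) (Fin n) F) : Prop :=
  (∀ i, h i i = 1) ∧ ∀ i j : Fin n, i < j → h i j = 0

/-- Membership in `N_n`: upper triangular with unit diagonal. -/
def IsUpperUni (h : Matrix (Fin n) (Fin n) F) : Prop :=
  (∀ i, h i i = 1) ∧ ∀ i j : Fin n, j < i → h i j = 0

/-- Membership in the subvariety `𝒲`: superdiagonal entries `1`,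
entries above the superdiagonal `0`. -/
def memW (X : Matrix (Fin (n + 1)) (Fin (n + 1)) F) : Prop :=
  ∀ i j : Fin (n + 1),
    ((j : ℕ) = (i : ℕ) + 1 → X i j = 1) ∧ ((i : ℕ) + 1 < (j : ℕ) → X i j = 0)

/-- `p : 𝒲 → 𝒱`, replacing the last row by zero. -/
def pMap (X : Matrix (Fin (n + 1)) (Fin (n + 1)) F) : Matrix (Fin (n + 1)) (Fin (n + 1)) F :=
  Matrix.of fun i j => if (i : ℕ) = n then 0 else X i j

/-- `p' : 𝒲 → 𝒱'`, replacing the last row and the first column by zero. -/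
def pMap' (X : Matrix (Fin (n + 1)) (Fin (n + 1)) F) : Matrix (Fin (n + 1)) (Fin (n + 1)) F :=
  Matrix.of fun i j => if (i : ℕ) = n ∨ (j : ℕ) = 0 then 0 else X i j

/-- The determinant of an element of `GL_n(F)`, as a unit of `F`. -/
def GLdet (h : Matrix.GeneralLinearGroup (Fin n) F) : Fˣ :=
  Units.map Matrix.detMonoidHom h

end ZhangRTF

open ZhangRTF

open Matrix MeasureTheory ZhangRTF

namespace ZhangRTF

set_option linter.unusedSectionVars false

section meas
variable {F : Type*} [NontriviallyNormedField F] [ProperSpace F]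
  [MeasureSpace F] [BorelSpace F] [(volume : Measure F).IsAddHaarMeasure]

/-- The normalization of the absolute value by the Haar measure. -/
def Normalized (F : Type*) [NontriviallyNormedField F] [MeasureSpace F] : Prop :=
  ∀ a : F, a ≠ 0 → ∀ S : Set F,
      volume ((fun x => a * x) '' S) = ENNReal.ofReal ‖a‖ * (volume : Measure F) S

lemma vol_preimage (hF : Normalized F) (a : F) (ha : a ≠ 0) (S : Set F) :
    ‖a‖ₑ * (volume : Measure F) ((a * ·) ⁻¹' S) = volume S := by
  rw [← ofReal_norm, ← hF a ha]
  congr 1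
  rw [Set.image_preimage_eq]
  intro y
  exact ⟨a⁻¹ * y, by simp [ha]⟩

variable {ι : Type*} [Fintype ι] [DecidableEq ι]

lemma meas_toLin (M : Matrix ι ι F) : Measurable (toLin' M) :=
  (LinearMap.continuous_on_pi (toLin' M)).measurable

lemma smul_map_diag (hF : Normalized F) {D : ι → F} (h : det (diagonal D) ≠ 0) :
    ‖det (diagonal D)‖ₑ • Measure.map (toLin' (diagonal D)) volume =
      (volume : Measure (ι → F)) := by
  refine (Measure.pi_eq fun s hs => ?_).symm
  simp only [det_diagonal, Measure.coe_smul, smul_eq_mul, Pi.smul_apply]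
  rw [Measure.map_apply (meas_toLin _) (MeasurableSet.univ_pi hs)]
  have :
    (Matrix.toLin' (diagonal D) ⁻¹' Set.pi Set.univ fun i : ι => s i) =
      Set.pi Set.univ fun i : ι => (D i * ·) ⁻¹' s i := by
    ext f
    simp [mulVec_diagonal]
  have B : ∀ i, ‖D i‖ₑ * volume ((D i * ·) ⁻¹' s i) = volume (s i) := by
    intro i
    have A : D i ≠ 0 := by
      simp only [det_diagonal, Ne] at h
      exact Finset.prod_ne_zero_iff.1 h i (Finset.mem_univ i)
    exact vol_preimage hF _ A _
  have C : ‖∏ i, D i‖ₑ = ∏ i, ‖D i‖ₑ := by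
    rw [← ofReal_norm, norm_prod, ENNReal.ofReal_prod_of_nonneg (fun i _ => norm_nonneg _)]
    simp
  rw [this, volume_pi_pi, C, ← Finset.prod_mul_distrib]
  simp only [B]

lemma mp_transvection (t : TransvectionStruct ι F) :
    MeasurePreserving (toLin' t.toMatrix) (volume : Measure (ι → F)) volume := by
  have ht : Measurable (toLin' t.toMatrix) := meas_toLin _
  refine ⟨ht, ?_⟩
  refine (Measure.pi_eq fun s hs ↦ ?_).symm
  have h2s : MeasurableSet (Set.univ.pi s) := .pi Set.countable_univ fun i _ ↦ hs i
  simp_rw [← Measure.pi_pi, ← lintegral_indicator_one h2s]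
  rw [lintegral_map (measurable_one.indicator h2s) ht, volume_pi]
  refine lintegral_eq_of_lmarginal_eq {t.i} ((measurable_one.indicator h2s).comp ht)
    (measurable_one.indicator h2s) ?_
  simp_rw [lmarginal_singleton]
  ext x
  cases t with | mk t_i t_j t_hij t_c =>
  simp [transvection, single_mulVec, t_hij.symm, ← Function.update_add,
    lintegral_add_right_eq_self fun xᵢ ↦ Set.indicator (Set.univ.pi s) 1 (Function.update x t_i xᵢ)]

lemma smul_map_matrix (hF : Normalized F) {M : Matrix ι ι F} (hM : det M ≠ 0) :
    ‖det M‖ₑ • Measure.map (toLin' M) volume = (volume : Measure (ι → F)) := by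
  apply diagonal_transvection_induction_of_det_ne_zero _ M hM
  · intro D hD
    exact smul_map_diag hF hD
  · intro t
    simp [(mp_transvection _).map_eq]
  · intro A B _ _ IHA IHB
    rw [toLin'_mul, det_mul, LinearMap.coe_comp, ← Measure.map_map (meas_toLin _) (meas_toLin _),
      enorm_mul, mul_smul, ← Measure.map_smul, IHB, IHA]

/-- Left multiplication by an invertible matrix, as a measurable equivalence. -/
def mulVecEquiv (M M' : Matrix ι ι F) (h : M * M' = 1) (h' : M' * M = 1) : (ι → F) ≃ᵐ (ι → F) where
  toFun := fun v => M *ᵥ v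
  invFun := fun v => M' *ᵥ v
  left_inv := fun v => by simp [h']
  right_inv := fun v => by simp [h]
  measurable_toFun := meas_toLin M
  measurable_invFun := meas_toLin M'

lemma det_ne_of_mul {M M' : Matrix ι ι F} (h : M * M' = 1) : det M ≠ 0 := by
  intro h0
  have := congrArg det h
  simp [h0] at this

lemma lintegral_mulVec (hF : Normalized F) (M M' : Matrix ι ι F) (h : M * M' = 1) (h' : M' * M = 1)
    (φ : (ι → F) → ENNReal) : ‖det M‖ₑ * ∫⁻ v, φ (M *ᵥ v) = ∫⁻ v, φ v := by
  have := smul_map_matrix (ι := ι) hF (M := M) (det_ne_of_mul h)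
  conv_rhs => rw [← this]
  rw [lintegral_smul_measure, smul_eq_mul]
  congr 1
  exact ((mulVecEquiv M M' h h').measurableEmbedding.lintegral_map φ).symm

/-- Columnwise multiplication, acting on families of vectors. -/
lemma lintegral_mulVec_pi (hF : Normalized F) {κ : Type*} [Fintype κ]
    (M M' : Matrix ι ι F) (h : M * M' = 1) (h' : M' * M = 1)
    (φ : (κ → ι → F) → ENNReal) :
    ‖det M‖ₑ ^ (Fintype.card κ) * ∫⁻ c : κ → ι → F, φ (fun j => M *ᵥ (c j)) = ∫⁻ c, φ c := by
  let e : (κ → ι → F) ≃ᵐ (κ → ι → F) := MeasurableEquiv.piCongrRight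
    (fun _ => mulVecEquiv M M' h h')
  have key : ‖det M‖ₑ ^ (Fintype.card κ) • Measure.map e volume =
      (volume : Measure (κ → ι → F)) := by
    refine (Measure.pi_eq fun s hs => ?_).symm
    rw [Measure.smul_apply, e.map_apply]
    have : e ⁻¹' (Set.univ.pi s) = Set.univ.pi (fun i => (fun v => M *ᵥ v) ⁻¹' s i) := by
      ext c
      simp [e, MeasurableEquiv.piCongrRight, mulVecEquiv, Set.mem_pi]
    rw [this, volume_pi_pi, smul_eq_mul, ← Finset.card_univ, ← Finset.prod_const,
      ← Finset.prod_mul_distrib]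
    refine Finset.prod_congr rfl fun i _ => ?_
    have h2 := smul_map_matrix (ι := ι) hF (M := M) (det_ne_of_mul h)
    conv_rhs => rw [← h2]
    rw [Measure.smul_apply, Measure.map_apply (meas_toLin _) (hs i), smul_eq_mul]
    rfl
  conv_rhs => rw [← key]
  rw [lintegral_smul_measure, smul_eq_mul]
  congr 1
  exact (e.measurableEmbedding.lintegral_map φ).symm

end meas
end ZhangRTF

open Matrix MeasureTheory ZhangRTF

namespace ZhangRTF
set_option linter.unusedSectionVars false

section alg
variable {F : Type*} [Field F] {n : ℕ}

@[simp] lemma emb_cc (h : Matrix (Fin n) (Fin n) F) (i j : Fin n) :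
    emb h i.castSucc j.castSucc = h i j := by simp [emb]
@[simp] lemma emb_cl (h : Matrix (Fin n) (Fin n) F) (i : Fin n) :
    emb h i.castSucc (Fin.last n) = 0 := by simp [emb]
@[simp] lemma emb_lc (h : Matrix (Fin n) (Fin n) F) (j : Fin n) :
    emb h (Fin.last n) j.castSucc = 0 := by simp [emb]
@[simp] lemma emb_ll (h : Matrix (Fin n) (Fin n) F) :
    emb h (Fin.last n) (Fin.last n) = 1 := by simp [emb]

lemma emb_mul (g h : Matrix (Fin n) (Fin n) F) : emb (g * h) = emb g * emb h := by
  ext i j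
  refine Fin.lastCases ?_ (fun i => ?_) i <;> refine Fin.lastCases ?_ (fun j => ?_) j <;>
    simp [Matrix.mul_apply, Fin.sum_univ_castSucc]

lemma emb_one : emb (1 : Matrix (Fin n) (Fin n) F) = 1 := by
  ext i j
  refine Fin.lastCases ?_ (fun i => ?_) i <;> refine Fin.lastCases ?_ (fun j => ?_) j <;>
    simp [Matrix.one_apply, (Fin.castSucc_lt_last _).ne, (Fin.castSucc_lt_last _).ne']

lemma det_emb (h : Matrix (Fin n) (Fin n) F) : (emb h).det = h.det := by
  rw [Matrix.det_succ_row _ (Fin.last n), Fin.sum_univ_castSucc]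
  simp only [emb_lc, emb_ll]
  have : (emb h).submatrix (Fin.last n).succAbove (Fin.last n).succAbove = h := by
    ext i j; simp
  rw [this]
  simp [← two_mul]

lemma xi_ss (i j : Fin (n + 1)) : (xiPlus (n + 1) : Matrix _ _ F) i.succ j.succ = xiPlus n i j := by
  simp [xiPlus]
lemma xi_zero (i : Fin (n + 1)) : (xiPlus n : Matrix _ _ F) i 0 = 0 := by
  simp [xiPlus]
lemma mul_xi_succ (M : Matrix (Fin (n + 1)) (Fin (n + 1)) F) (i : Fin (n + 1)) (j : Fin n) :
    (M * (xiPlus n : Matrix (Fin (n + 1)) (Fin (n + 1)) F)) i j.succ = M i j.castSucc := by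
  simp only [Matrix.mul_apply, xiPlus, of_apply]
  rw [Finset.sum_eq_single j.castSucc]
  · simp
  · intro b _ hb
    have : ¬ ((j.succ : Fin (n+1)) : ℕ) = (b : ℕ) + 1 := by
      intro h
      apply hb
      ext
      simp at h ⊢
      omega
    rw [if_neg this, mul_zero]
  · simp

lemma emb_ss (h : Matrix (Fin (n + 1)) (Fin (n + 1)) F) (i j : Fin (n + 1)) :
    emb h i.succ j.succ = emb (h.submatrix Fin.succ Fin.succ) i j := by
  refine Fin.lastCases ?_ (fun i => ?_) i <;> refine Fin.lastCases ?_ (fun j => ?_) j <;>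
    simp only [Fin.succ_last, ← Fin.castSucc_succ, emb_cc, emb_cl, emb_lc, emb_ll, submatrix_apply]

lemma emb_s0 (h : Matrix (Fin (n + 1)) (Fin (n + 1)) F) (h0 : ∀ i : Fin n, h i.succ 0 = 0)
    (i : Fin (n + 1)) :
    emb h i.succ 0 = 0 := by
  rw [← Fin.castSucc_zero]
  refine Fin.lastCases ?_ (fun i => ?_) i <;>
    simp only [Fin.succ_last, ← Fin.castSucc_succ, emb_cc, emb_lc, h0]

lemma det_col (h : Matrix (Fin (n + 1)) (Fin (n + 1)) F) (h0 : ∀ i : Fin n, h i.succ 0 = 0) :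
    h.det = h 0 0 * (h.submatrix Fin.succ Fin.succ).det := by
  rw [Matrix.det_succ_column_zero, Fin.sum_univ_succ]
  simp [h0]

end alg

section normed
variable {F : Type*} [NontriviallyNormedField F] [IsUltrametricDist F] {n : ℕ}

/-- `h` is invertible and `h · ξ₊` has entries bounded by `C`. -/
def Good (C : ℝ) (h : Matrix (Fin n) (Fin n) F) : Prop :=
  h.det ≠ 0 ∧ ∃ X : Matrix (Fin (n + 1)) (Fin (n + 1)) F, (∀ i j, ‖X i j‖ ≤ C) ∧
    X * emb h = emb h * xiPlus n

lemma norm_mul_le {l m p : Type*} [Fintype m] {C D : ℝ} (hC : 0 ≤ C) (hD : 0 ≤ D)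
    {A : Matrix l m F} {B : Matrix m p F}
    (hA : ∀ i j, ‖A i j‖ ≤ C) (hB : ∀ i j, ‖B i j‖ ≤ D) (i : l) (j : p) :
    ‖(A * B) i j‖ ≤ C * D := by
  rw [Matrix.mul_apply]
  refine IsUltrametricDist.norm_sum_le_of_forall_le_of_nonneg (by positivity) fun k _ => ?_
  rw [norm_mul]
  exact mul_le_mul (hA _ _) (hB _ _) (norm_nonneg _) hC

lemma norm_emb_le {k : Matrix (Fin n) (Fin n) F} (hk : ∀ i j, ‖k i j‖ ≤ 1) (i j) :
    ‖emb k i j‖ ≤ 1 := by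
  refine Fin.lastCases ?_ (fun i => ?_) i <;> refine Fin.lastCases ?_ (fun j => ?_) j <;>
    simp [hk]

/-- A pair of mutually inverse integral matrices. -/
structure KPair {m : Type*} [Fintype m] [DecidableEq m] (k k' : Matrix m m F) : Prop where
  mul : k * k' = 1
  mul' : k' * k = 1
  le : ∀ i j, ‖k i j‖ ≤ 1
  le' : ∀ i j, ‖k' i j‖ ≤ 1
  det : ‖k.det‖ₑ = 1

lemma Good.smul {C : ℝ} (hC : 0 ≤ C) {h k k' : Matrix (Fin n) (Fin n) F} (hk : KPair k k')
    (hh : Good C h) : Good C (k * h) := by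
  obtain ⟨hd, X, hX, hXh⟩ := hh
  refine ⟨?_, emb k * X * emb k', ?_, ?_⟩
  · rw [det_mul]
    refine mul_ne_zero ?_ hd
    intro h0
    have := hk.det
    simp [h0] at this
  · intro i j
    have h1 := norm_mul_le zero_le_one hC (norm_emb_le hk.le) hX
    have h2 := norm_mul_le (by simpa using hC) zero_le_one h1 (norm_emb_le hk.le') i j
    simpa using h2
  · rw [emb_mul, Matrix.mul_assoc, ← Matrix.mul_assoc (emb k'), ← emb_mul, hk.mul', emb_one,
      Matrix.one_mul, Matrix.mul_assoc, hXh, Matrix.mul_assoc]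

lemma KPair.det' {m : Type*} [Fintype m] [DecidableEq m] {k k' : Matrix m m F} (hk : KPair k k') :
    ‖k'.det‖ₑ = 1 := by
  have := congrArg (fun M => ‖Matrix.det M‖ₑ) hk.mul
  simpa [hk.det] using this

lemma KPair.symm {m : Type*} [Fintype m] [DecidableEq m] {k k' : Matrix m m F} (hk : KPair k k') :
    KPair k' k := ⟨hk.mul', hk.mul, hk.le', hk.le, hk.det'⟩

lemma good_smul_iff {C : ℝ} (hC : 0 ≤ C) {h k k' : Matrix (Fin n) (Fin n) F} (hk : KPair k k') :
    Good C (k * h) ↔ Good C h := by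
  refine ⟨fun H => ?_, fun H => H.smul hC hk⟩
  have := H.smul hC hk.symm
  rwa [← Matrix.mul_assoc, hk.mul', Matrix.one_mul] at this

lemma good_succ {C : ℝ} {h : Matrix (Fin (n + 1)) (Fin (n + 1)) F}
    (h0 : ∀ i : Fin n, h i.succ 0 = 0) (hh : Good C h) :
    Good C (h.submatrix Fin.succ Fin.succ) ∧ ∃ q : Fin (n + 1) → F, (∀ i, ‖q i‖ ≤ C) ∧
      q ᵥ* emb (h.submatrix Fin.succ Fin.succ) = h 0 := by
  obtain ⟨hd, X, hX, hXh⟩ := hh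
  rw [det_col h h0] at hd
  have ha : h 0 0 ≠ 0 := left_ne_zero_of_mul hd
  have hX0 : ∀ i, X i 0 = 0 := by
    intro i
    have := congrFun (congrFun hXh i) 0
    simp only [Matrix.mul_apply, xi_zero] at this
    rw [Fin.sum_univ_succ] at this
    simp only [emb_s0 h h0] at this
    have e : emb h 0 0 = h 0 0 := by
      rw [← emb_cc h 0 0]; rfl
    simpa [e, ha] using this
  refine ⟨⟨right_ne_zero_of_mul hd, X.submatrix Fin.succ Fin.succ, fun i j => hX _ _, ?_⟩,
    fun j => X 0 j.succ, fun j => hX _ _, ?_⟩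
  · ext i j
    have := congrFun (congrFun hXh i.succ) j.succ
    simp only [Matrix.mul_apply] at this ⊢
    rw [Fin.sum_univ_succ] at this
    conv_rhs at this => rw [Fin.sum_univ_succ]
    simpa only [hX0, emb_s0 h h0, zero_mul, zero_add, emb_ss, xi_ss, submatrix_apply] using this
  · ext j
    have := congrFun (congrFun hXh 0) j.succ
    rw [mul_xi_succ, Matrix.mul_apply, Fin.sum_univ_succ, hX0, zero_mul, zero_add] at this
    simp only [emb_ss] at this
    rw [← Fin.castSucc_zero, emb_cc] at this
    exact this

/-- Integral elimination: a vector with `i`-th entry of maximal norm is moved to a multiple of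
the zeroth basis vector. -/
lemma exists_kpair (v : Fin (n + 1) → F) (i : Fin (n + 1)) (hi : v i ≠ 0)
    (hv : ∀ j, ‖v j‖ ≤ ‖v i‖) :
    ∃ k k' : Matrix (Fin (n + 1)) (Fin (n + 1)) F, KPair k k' ∧ k *ᵥ v = Pi.single 0 (v i) := by
  let z : Fin (n + 1) → F := fun j => if j = i then 0 else v j / v i
  have hz : ∀ j, ‖z j‖ ≤ 1 := by
    intro j
    simp only [z]
    split_ifs
    · simp
    · rw [norm_div]
      exact div_le_one_of_le₀ (hv j) (norm_nonneg _)
  have hzi : z i = 0 := by simp [z]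
  let e : Fin (n + 1) → F := Pi.single i 1
  let L : Matrix (Fin (n + 1)) (Fin (n + 1)) F := 1 - vecMulVec z e
  let L' : Matrix (Fin (n + 1)) (Fin (n + 1)) F := 1 + vecMulVec z e
  have hsq : vecMulVec z e * vecMulVec z e = 0 := by
    rw [vecMulVec_mul_vecMulVec]
    simp [e, hzi]
  have hLL : L * L' = 1 := by
    simp only [L, L']
    rw [sub_mul, mul_add, mul_add, hsq]; simp
  have hLL' : L' * L = 1 := mul_eq_one_comm.mp hLL
  have hent : ∀ j l, ‖vecMulVec z e j l‖ ≤ 1 := by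
    intro j l
    simp only [vecMulVec_apply, e, Pi.single_apply]
    split_ifs
    · simpa using hz j
    · simp
  have h1 : ∀ j l, ‖(1 : Matrix (Fin (n + 1)) (Fin (n + 1)) F) j l‖ ≤ 1 := by
    intro j l
    rw [Matrix.one_apply]
    split_ifs <;> simp
  have hL : ∀ j l, ‖L j l‖ ≤ 1 := by
    intro j l
    have h2 : L j l = (1 : Matrix (Fin (n + 1)) (Fin (n + 1)) F) j l + (-vecMulVec z e j l) := by
      simp [L, sub_eq_add_neg]
    rw [h2]
    refine (IsUltrametricDist.norm_add_le_max _ _).trans (max_le (h1 j l) ?_)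
    rw [norm_neg]
    exact hent j l
  have hL' : ∀ j l, ‖L' j l‖ ≤ 1 := fun j l =>
    (IsUltrametricDist.norm_add_le_max _ _).trans (max_le (h1 j l) (hent j l))
  have hdet : L.det = 1 := by
    have : L = 1 + replicateCol Unit (-z) * replicateRow Unit e := by
      ext j l
      simp [L, vecMulVec_apply, Matrix.mul_apply, sub_eq_add_neg]
    rw [this, det_one_add_replicateCol_mul_replicateRow]
    simp [e, hzi]
  have hLv : L *ᵥ v = Pi.single i (v i) := by
    ext j
    simp only [L, sub_mulVec, one_mulVec, vecMulVec_mulVec, Pi.sub_apply, e]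
    by_cases hj : j = i
    · subst hj; simp [hzi]
    · simp [z, hj, hi]
  let σ := Equiv.swap (0 : Fin (n + 1)) i
  refine ⟨L.submatrix σ id, L'.submatrix id σ, ⟨?_, ?_, fun _ _ => hL _ _, fun _ _ => hL' _ _, ?_⟩,
    ?_⟩
  · have := Matrix.submatrix_mul_equiv L L' σ (Equiv.refl _) σ
    simp only [Equiv.coe_refl] at this
    rw [this, hLL]
    simp
  · have := Matrix.submatrix_mul_equiv L' L id σ id
    rw [this, hLL']
    simp
  · rw [Matrix.det_permute, hdet]
    rcases Int.units_eq_one_or (Equiv.Perm.sign σ) with h | h <;> simp [h]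
  · ext j
    have : (L.submatrix σ id *ᵥ v) j = (L *ᵥ v) (σ j) := rfl
    rw [this, hLv]
    simp only [Pi.single_apply, σ]
    congr 1
    rw [Equiv.swap_apply_eq_iff, Equiv.swap_apply_right]

end normed
end ZhangRTF

open Matrix MeasureTheory ZhangRTF

namespace ZhangRTF
set_option linter.unusedSectionVars false

section ints
variable {F : Type*} [NontriviallyNormedField F] [IsUltrametricDist F] [ProperSpace F]
  [MeasureSpace F] [BorelSpace F] [(volume : Measure F).IsAddHaarMeasure] {n : ℕ}

lemma lintegral_mul_F (hF : Normalized F) (a : F) (ha : a ≠ 0) (φ : F → ENNReal) :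
    ‖a‖ₑ * ∫⁻ x, φ (a * x) = ∫⁻ x, φ x := by
  have key : ‖a‖ₑ • Measure.map (MeasurableEquiv.mulLeft₀ a ha) volume = (volume : Measure F) := by
    ext s hs
    rw [Measure.smul_apply, MeasurableEquiv.map_apply, smul_eq_mul]
    exact vol_preimage hF a ha s
  conv_rhs => rw [← key]
  rw [lintegral_smul_measure, smul_eq_mul]
  congr 1
  exact ((MeasurableEquiv.mulLeft₀ a ha).measurableEmbedding.lintegral_map φ).symm

lemma enorm_le_of_norm_le {x y : F} (h : ‖x‖ ≤ ‖y‖) : ‖x‖ₑ ≤ ‖y‖ₑ := by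
  rw [← ofReal_norm, ← ofReal_norm]
  exact ENNReal.ofReal_le_ofReal h

lemma int_one (hF : Normalized F) (C : ℝ) (t : ℝ) (ht : -1 < t) :
    ∫⁻ x : F, {x : F | ‖x‖ ≤ C}.indicator (fun x => ‖x‖ₑ ^ t) x < ⊤ := by
  obtain ⟨p, hp0, hp1⟩ := NormedField.exists_norm_lt_one F
  have hpne : p ≠ 0 := norm_pos_iff.mp hp0
  let S : ℕ → Set F := fun k => {x | ‖p‖ ^ (k + 1) * C < ‖x‖ ∧ ‖x‖ ≤ ‖p‖ ^ k * C}
  have hSm : ∀ k, MeasurableSet (S k) := fun k =>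
    (measurableSet_lt measurable_const measurable_norm).inter
      (measurableSet_le measurable_norm measurable_const)
  have hcov : {x : F | ‖x‖ ≤ C} ⊆ {0} ∪ ⋃ k, S k := by
    intro x hx
    by_cases hx0 : x = 0
    · left; exact hx0
    right
    have hxp : 0 < ‖x‖ := norm_pos_iff.mpr hx0
    have hC : 0 < C := hxp.trans_le hx
    have hex : ∃ k : ℕ, ‖p‖ ^ (k + 1) * C < ‖x‖ := by
      obtain ⟨k, hk⟩ := exists_pow_lt_of_lt_one (div_pos hxp hC) hp1
      refine ⟨k, ?_⟩
      rw [lt_div_iff₀ hC] at hk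
      refine lt_of_le_of_lt ?_ hk
      exact mul_le_mul_of_nonneg_right (pow_le_pow_of_le_one hp0.le hp1.le (Nat.le_succ k)) hC.le
    classical
    refine Set.mem_iUnion.mpr ⟨Nat.find hex, Nat.find_spec hex, ?_⟩
    rcases hk : Nat.find hex with _ | m
    · simpa using hx
    · have := Nat.find_min hex (m := m) (by omega)
      exact not_lt.mp this
  have h0 : ∫⁻ x in ({0} : Set F), ‖x‖ₑ ^ t = 0 := by
    have hz : (volume : Measure F) {0} = 0 := by
      have h1 := hF p hpne {0}
      simp only [Set.image_singleton, mul_zero] at h1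
      by_contra hne
      have hfin : (volume : Measure F) {0} ≠ ⊤ := (isCompact_singleton.measure_lt_top).ne
      have h2 : ENNReal.ofReal ‖p‖ * volume ({0} : Set F) < 1 * volume ({0} : Set F) := by
        refine (ENNReal.mul_lt_mul_iff_left hne hfin).mpr ?_
        exact ENNReal.ofReal_lt_one.mpr hp1
      rw [one_mul, ← h1] at h2
      exact lt_irrefl _ h2
    exact setLIntegral_measure_zero _ _ hz
  have hSk : ∀ k, ∫⁻ x in S k, ‖x‖ₑ ^ t = (‖p‖ₑ ^ (1 + t)) ^ k * ∫⁻ x in S 0, ‖x‖ₑ ^ t := by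
    intro k
    rw [← lintegral_indicator (hSm k), ← lintegral_indicator (hSm 0),
      ← lintegral_mul_F hF (p ^ k) (pow_ne_zero _ hpne)]
    have hpe0 : ‖p‖ₑ ≠ 0 := by simpa using hpne
    have hpet : ‖p‖ₑ ≠ ⊤ := by simp
    have : ∀ x, (S k).indicator (fun x => ‖x‖ₑ ^ t) (p ^ k * x) =
        (‖p‖ₑ ^ k) ^ t * (S 0).indicator (fun x => ‖x‖ₑ ^ t) x := by
      intro x
      have hmem : p ^ k * x ∈ S k ↔ x ∈ S 0 := by
        simp only [S, Set.mem_ofPred_eq, norm_mul, norm_pow]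
        have hk : 0 < ‖p‖ ^ k := pow_pos hp0 k
        rw [pow_succ, mul_assoc, mul_lt_mul_iff_right₀ hk, mul_le_mul_iff_right₀ hk]
        simp
      by_cases hx : x ∈ S 0
      · rw [Set.indicator_of_mem hx, Set.indicator_of_mem (hmem.mpr hx), enorm_mul, enorm_pow,
          ENNReal.mul_rpow_of_ne_top (by simp) (by simp)]
      · rw [Set.indicator_of_notMem hx, Set.indicator_of_notMem (fun h => hx (hmem.mp h)), mul_zero]
    simp_rw [this]
    rw [lintegral_const_mul' _ _ (by
      apply ENNReal.rpow_ne_top_of_ne_zero <;> simp [hpne]), ← mul_assoc]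
    congr 1
    rw [enorm_pow, ← ENNReal.rpow_natCast, ← ENNReal.rpow_natCast, ← ENNReal.rpow_mul,
      ← ENNReal.rpow_mul, ← ENNReal.rpow_add _ _ hpe0 hpet]
    ring_nf
  have hS0 : ∫⁻ x in S 0, ‖x‖ₑ ^ t < ⊤ := by
    by_cases hC : C ≤ 0
    · have : S 0 ⊆ {0} := by
        intro x hx
        have := hx.2
        simp only [pow_zero, one_mul] at this
        simpa using this.trans hC
      refine lt_of_le_of_lt (lintegral_mono_set this) ?_
      rw [h0]; simp
    push Not at hC
    have hb : ∀ x ∈ S 0, ‖x‖ₑ ^ t ≤ ENNReal.ofReal C ^ t + ENNReal.ofReal (‖p‖ * C) ^ t := by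
      intro x hx
      simp only [S, Set.mem_ofPred_eq, pow_zero, one_mul, zero_add, pow_one] at hx
      rw [← ofReal_norm]
      rcases le_total 0 t with h | h
      · refine le_trans ?_ le_self_add
        exact ENNReal.rpow_le_rpow (ENNReal.ofReal_le_ofReal hx.2) h
      · refine le_trans ?_ le_add_self
        rw [← neg_neg t, ENNReal.rpow_neg _ (-t), ENNReal.rpow_neg _ (-t), ENNReal.inv_le_inv]
        exact ENNReal.rpow_le_rpow (ENNReal.ofReal_le_ofReal hx.1.le) (by linarith)
    refine lt_of_le_of_lt (setLIntegral_mono' (hSm 0) hb) ?_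
    rw [setLIntegral_const]
    refine ENNReal.mul_lt_top (ENNReal.add_lt_top.mpr ⟨?_, ?_⟩) ?_
    · exact (ENNReal.rpow_ne_top_of_ne_zero (by simpa using hC) (by simp)).lt_top
    · exact (ENNReal.rpow_ne_top_of_ne_zero (by simp only [ne_eq, ENNReal.ofReal_eq_zero, not_le]; positivity)
        ENNReal.ofReal_ne_top).lt_top
    · refine lt_of_le_of_lt (measure_mono (t := Metric.closedBall 0 C) ?_)
        (isCompact_closedBall _ _).measure_lt_top
      intro x hx
      simpa using hx.2
  rw [lintegral_indicator (measurableSet_le measurable_norm measurable_const)]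
  refine lt_of_le_of_lt (lintegral_mono_set hcov) ?_
  refine lt_of_le_of_lt (lintegral_union_le _ _ _) ?_
  rw [h0, zero_add]
  refine lt_of_le_of_lt (lintegral_iUnion_le _ _) ?_
  rw [tsum_congr hSk, ENNReal.tsum_mul_right, ENNReal.tsum_geometric]
  refine ENNReal.mul_lt_top ?_ hS0
  rw [ENNReal.inv_lt_top, tsub_pos_iff_lt]
  refine ENNReal.rpow_lt_one ?_ (by linarith)
  rw [← ofReal_norm]
  exact ENNReal.ofReal_lt_one.mpr hp1

lemma lint_insert {α : Type*} [MeasureSpace α] [SigmaFinite (volume : Measure α)]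
    (i : Fin (n + 1)) (φ : (Fin (n + 1) → α) → ENNReal) :
    ∫⁻ v, φ v = ∫⁻ p : α × (Fin n → α), φ (i.insertNth p.1 p.2) := by
  have := ((volume_preserving_piFinSuccAbove (fun _ : Fin (n + 1) => α) i).symm).lintegral_comp_emb
    (MeasurableEquiv.measurableEmbedding _) φ
  rw [← this]
  rfl

lemma lint_insert_pi {α : Type*} [MeasureSpace α] [SigmaFinite (volume : Measure α)] {m : ℕ}
    (φ : (Fin m → Fin (n + 1) → α) → ENNReal) :
    ∫⁻ v, φ v = ∫⁻ p : (Fin m → α) × (Fin m → Fin n → α),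
      φ (fun j => (0 : Fin (n + 1)).insertNth (p.1 j) (p.2 j)) := by
  have h1 := volume_preserving_pi
    (fun _ : Fin m => volume_preserving_piFinSuccAbove (fun _ : Fin (n + 1) => α) 0)
  have h2 := volume_measurePreserving_arrowProdEquivProdArrow α (Fin n → α) (Fin m)
  let e1 : (Fin m → Fin (n + 1) → α) ≃ᵐ (Fin m → α × (Fin n → α)) :=
    MeasurableEquiv.piCongrRight (fun _ => MeasurableEquiv.piFinSuccAbove (fun _ => α) 0)
  have h3 : MeasurePreserving (e1.trans (MeasurableEquiv.arrowProdEquivProdArrow α (Fin n → α) (Fin m)))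
    volume volume := h2.comp h1
  have := h3.symm.lintegral_comp_emb (MeasurableEquiv.measurableEmbedding _) φ
  rw [← this]
  rfl

lemma vol_ball (hF : Normalized F) (a : F) (ha : a ≠ 0) :
    (volume : Measure F) {x | ‖x‖ ≤ ‖a‖} = ‖a‖ₑ * (volume : Measure F) {x | ‖x‖ ≤ 1} := by
  rw [← ofReal_norm, ← hF a ha]
  congr 1
  ext x
  simp only [Set.mem_ofPred_eq, Set.mem_image]
  constructor
  · intro h
    refine ⟨a⁻¹ * x, ?_, by field_simp⟩
    rw [norm_mul, norm_inv, inv_mul_le_iff₀ (norm_pos_iff.mpr ha)]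
    simpa using h
  · rintro ⟨y, hy, rfl⟩
    rw [norm_mul]
    exact mul_le_of_le_one_right (norm_nonneg _) hy

lemma vol_ball_lt (C : ℝ) : (volume : Measure F) {x | ‖x‖ ≤ C} < ⊤ := by
  refine lt_of_le_of_lt (measure_mono (t := Metric.closedBall 0 C) ?_)
        (isCompact_closedBall _ _).measure_lt_top
  intro x hx
  simpa using hx

lemma vol_ball_pi (C : ℝ) : (volume : Measure (Fin n → F)) {z | ∀ j, ‖z j‖ ≤ C} =
    (volume : Measure F) {x | ‖x‖ ≤ C} ^ n := by
  have : {z : Fin n → F | ∀ j, ‖z j‖ ≤ C} = Set.univ.pi (fun _ => {x | ‖x‖ ≤ C}) := by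
    ext z; simp
  rw [this, volume_pi_pi]
  simp

lemma meas_ball_pi (C : ℝ) : MeasurableSet {z : Fin n → F | ∀ j, ‖z j‖ ≤ C} := by
  rw [Set.ofPred_forall]
  exact MeasurableSet.iInter fun j =>
    measurableSet_le (measurable_norm.comp (measurable_pi_apply j)) measurable_const

/-- The constant appearing in the inner integral. -/
noncomputable def cst (F : Type*) [NontriviallyNormedField F] [MeasureSpace F] (n : ℕ) (C t : ℝ) :
    ENNReal :=
  ∫⁻ q : Fin (n + 1) → F, {q : Fin (n + 1) → F | ∀ i, ‖q i‖ ≤ C}.indicator (fun q => ‖q 0‖ₑ ^ t) q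

lemma cst_lt (hF : Normalized F) (C : ℝ) (t : ℝ) (ht : -1 < t) :
    cst F n C t < ⊤ := by
  unfold cst
  rw [lint_insert 0]
  refine lt_of_le_of_lt (lintegral_prod_le _) ?_
  have : ∀ (x : F) (z : Fin n → F), {q : Fin (n + 1) → F | ∀ i, ‖q i‖ ≤ C}.indicator
      (fun q => ‖q 0‖ₑ ^ t) ((0 : Fin (n + 1)).insertNth x z) ≤
      ({x : F | ‖x‖ ≤ C}.indicator (fun x => ‖x‖ₑ ^ t) x) *
        {z : Fin n → F | ∀ j, ‖z j‖ ≤ C}.indicator 1 z := by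
    intro x z
    by_cases h : (0 : Fin (n + 1)).insertNth x z ∈ {q : Fin (n + 1) → F | ∀ i, ‖q i‖ ≤ C}
    · rw [Set.indicator_of_mem h]
      have hx : x ∈ {x : F | ‖x‖ ≤ C} := by simpa using h 0
      have hz : z ∈ {z : Fin n → F | ∀ j, ‖z j‖ ≤ C} := by
        intro j
        simpa using h j.succ
      rw [Set.indicator_of_mem hx, Set.indicator_of_mem hz]
      simp
    · rw [Set.indicator_of_notMem h]; exact zero_le
  refine lt_of_le_of_lt (lintegral_mono fun x => lintegral_mono fun z => this x z) ?_
  simp_rw [lintegral_const_mul _ ((measurable_one.indicator (meas_ball_pi (F := F) (n := n) C))),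
    lintegral_indicator_one (meas_ball_pi (F := F) (n := n) C), vol_ball_pi]
  have hfin := ENNReal.pow_lt_top (n := n) (vol_ball_lt (F := F) C)
  rw [lintegral_mul_const' _ _ hfin.ne]
  exact ENNReal.mul_lt_top (int_one hF C t ht) hfin

end ints
end ZhangRTF

open Matrix MeasureTheory ZhangRTF

namespace ZhangRTF
set_option linter.unusedSectionVars false

section ints
variable {F : Type*} [NontriviallyNormedField F] [IsUltrametricDist F] [ProperSpace F]
  [MeasureSpace F] [BorelSpace F] [(volume : Measure F).IsAddHaarMeasure] {n : ℕ}

lemma enorm_pi_eq (v : Fin (n + 1) → F) (i : Fin (n + 1)) (hv : ∀ j, ‖v j‖ ≤ ‖v i‖) :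
    ‖v‖ₑ = ‖v i‖ₑ := by
  have : ‖v‖ = ‖v i‖ := le_antisymm ((pi_norm_le_iff_of_nonneg (norm_nonneg _)).mpr hv)
    (norm_le_pi_norm v i)
  rw [← ofReal_norm, ← ofReal_norm, this]

lemma exists_kpair_enorm (v : Fin (n + 1) → F) (hv : v ≠ 0) :
    ∃ (k k' : Matrix (Fin (n + 1)) (Fin (n + 1)) F) (a : F), KPair k k' ∧ ‖a‖ₑ = ‖v‖ₑ ∧ a ≠ 0 ∧
      k *ᵥ v = Pi.single 0 a := by
  obtain ⟨i, hi⟩ := Finite.exists_max (fun j => ‖v j‖)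
  have hvi : v i ≠ 0 := by
    intro h0
    apply hv
    ext j
    have := hi j
    simpa [h0] using this
  obtain ⟨k, k', hk, h⟩ := exists_kpair v i hvi hi
  exact ⟨k, k', v i, hk, (enorm_pi_eq v i hi).symm, hvi, h⟩

lemma KPair.transpose {m : Type*} [Fintype m] [DecidableEq m] {k k' : Matrix m m F}
    (hk : KPair k k') : KPair kᵀ k'ᵀ :=
  ⟨by rw [← transpose_mul, hk.mul', transpose_one], by rw [← transpose_mul, hk.mul, transpose_one],
    fun i j => hk.le j i, fun i j => hk.le' j i, by rw [det_transpose]; exact hk.det⟩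

lemma KPair.emb {k k' : Matrix (Fin n) (Fin n) F} (hk : KPair k k') :
    KPair (emb k) (emb k') :=
  ⟨by rw [← emb_mul, hk.mul, emb_one], by rw [← emb_mul, hk.mul', emb_one],
    norm_emb_le hk.le, norm_emb_le hk.le', by rw [det_emb]; exact hk.det⟩

lemma KPair.bound {m : Type*} [Fintype m] [DecidableEq m] {k k' : Matrix m m F}
    (hk : KPair k k') {C : ℝ} (hC : 0 ≤ C) {v : m → F} (hv : ∀ i, ‖v i‖ ≤ C) (i : m) :
    ‖(k *ᵥ v) i‖ ≤ C := by
  refine IsUltrametricDist.norm_sum_le_of_forall_le_of_nonneg hC fun j _ => ?_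
  rw [norm_mul]
  have := mul_le_mul (hk.le i j) (hv j) (norm_nonneg _) zero_le_one
  simpa using this

lemma KPair.enorm {m : Type*} [Fintype m] [DecidableEq m] {k k' : Matrix m m F}
    (hk : KPair k k') (v : m → F) : ‖k *ᵥ v‖ₑ = ‖v‖ₑ := by
  have h : ∀ {k k' : Matrix m m F}, KPair k k' → ∀ v : m → F, ‖k *ᵥ v‖ ≤ ‖v‖ := by
    intro k k' hk v
    refine (pi_norm_le_iff_of_nonneg (norm_nonneg _)).mpr ?_
    exact hk.bound (norm_nonneg v) (norm_le_pi_norm v)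
  have : ‖k *ᵥ v‖ = ‖v‖ := by
    refine le_antisymm (h hk v) ?_
    have := h hk.symm (k *ᵥ v)
    rwa [mulVec_mulVec, hk.mul', one_mulVec] at this
  rw [← ofReal_norm, ← ofReal_norm, this]

/-- The inner integral over a row. -/
lemma inner_le (hF : Normalized F) {C : ℝ} (hC : 0 ≤ C) (t : ℝ)
    (E : Matrix (Fin (n + 1)) (Fin (n + 1)) F) (hE : E.det ≠ 0) :
    ∫⁻ w : Fin (n + 1) → F, {w | ∃ q : Fin (n + 1) → F, (∀ i, ‖q i‖ ≤ C) ∧ q ᵥ* E = w}.indicator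
      (fun w => ‖w 0‖ₑ ^ t) w ≤ ‖E.det‖ₑ * ‖fun i => E i 0‖ₑ ^ t * cst F n C t := by
  set c : Fin (n + 1) → F := fun i => E i 0 with hc
  have hu : IsUnit E.det := isUnit_iff_ne_zero.mpr hE
  have hE1 : Eᵀ * E⁻¹ᵀ = 1 := by rw [← transpose_mul, nonsing_inv_mul _ hu, transpose_one]
  have hE2 : E⁻¹ᵀ * Eᵀ = 1 := by rw [← transpose_mul, mul_nonsing_inv _ hu, transpose_one]
  rw [← lintegral_mulVec hF Eᵀ E⁻¹ᵀ hE1 hE2, det_transpose, mul_assoc]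
  refine mul_le_mul_right ?_ _
  have hc0 : c ≠ 0 := by
    intro h
    apply hE
    exact det_eq_zero_of_column_eq_zero 0 (fun i => congrFun h i)
  obtain ⟨k, k', a, hk, hac, ha, hkc⟩ := exists_kpair_enorm c hc0
  rw [← lintegral_mulVec hF kᵀ k'ᵀ hk.transpose.mul hk.transpose.mul', hk.transpose.det, one_mul]
  unfold cst
  rw [← lintegral_const_mul' _ _ (by
    apply ENNReal.rpow_ne_top_of_ne_zero <;> simp [hc0])]
  refine lintegral_mono fun q => ?_
  by_cases h : Eᵀ *ᵥ (kᵀ *ᵥ q) ∈ {w | ∃ q : Fin (n + 1) → F, (∀ i, ‖q i‖ ≤ C) ∧ q ᵥ* E = w}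
  · rw [Set.indicator_of_mem h]
    obtain ⟨q', hq', hqe⟩ := h
    have h1 : q' = kᵀ *ᵥ q := by
      have := congrArg (fun w => E⁻¹ᵀ *ᵥ w) hqe
      simpa only [← mulVec_transpose, mulVec_mulVec, ← Matrix.mul_assoc, hE2, one_mulVec,
        Matrix.one_mul] using this
    subst h1
    have h2 : q ∈ {q : Fin (n + 1) → F | ∀ i, ‖q i‖ ≤ C} := by
      intro i
      have := hk.transpose.symm.bound hC hq' i
      rwa [mulVec_mulVec, hk.transpose.mul', one_mulVec] at this
    rw [Set.indicator_of_mem h2]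
    have h3 : (Eᵀ *ᵥ (kᵀ *ᵥ q)) 0 = a * q 0 := by
      have : (Eᵀ *ᵥ (kᵀ *ᵥ q)) 0 = c ⬝ᵥ (kᵀ *ᵥ q) := rfl
      rw [this, mulVec_transpose, dotProduct_comm, ← dotProduct_mulVec, hkc]
      simp [mul_comm]
    rw [h3, enorm_mul, hac, ENNReal.mul_rpow_of_ne_top (by simp) (by simp)]
  · rw [Set.indicator_of_notMem h]; exact zero_le

/-- Radial integration bound. -/
lemma radial_le (hF : Normalized F) (Θ : (Fin (n + 1) → F) → ENNReal) (Φ : F → ENNReal)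
    (h0 : Θ 0 = 0) (hΘ : ∀ v i, v i ≠ 0 → (∀ j, ‖v j‖ ≤ ‖v i‖) → Θ v ≤ Φ (v i)) :
    ∫⁻ v, Θ v ≤ (n + 1 : ℕ) * ((volume : Measure F) {x | ‖x‖ ≤ 1} ^ n *
      ∫⁻ a, Φ a * ‖a‖ₑ ^ n) := by
  let A : Fin (n + 1) → Set (Fin (n + 1) → F) := fun i => {v | v i ≠ 0 ∧ ∀ j, ‖v j‖ ≤ ‖v i‖}
  have hA : ∀ i, MeasurableSet (A i) := by
    intro i
    have h1 : MeasurableSet {v : Fin (n + 1) → F | v i ≠ 0} :=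
      (isOpen_ne_fun (continuous_apply i) continuous_const).measurableSet
    have h2 : MeasurableSet {v : Fin (n + 1) → F | ∀ j, ‖v j‖ ≤ ‖v i‖} := by
      rw [Set.ofPred_forall]
      exact MeasurableSet.iInter fun j =>
        measurableSet_le (measurable_norm.comp (measurable_pi_apply j))
          (measurable_norm.comp (measurable_pi_apply i))
    exact h1.inter h2
  have hcov : ∫⁻ v, Θ v ≤ ∫⁻ v in ⋃ i, A i, Θ v := by
    rw [← lintegral_indicator (MeasurableSet.iUnion hA)]
    refine lintegral_mono fun v => ?_
    by_cases hv : v = 0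
    · simp [hv, h0]
    · obtain ⟨i, hi⟩ := Finite.exists_max (fun j => ‖v j‖)
      have hvi : v i ≠ 0 := by
        intro h0
        apply hv
        ext j
        have := hi j
        simpa [h0] using this
      have hm : v ∈ ⋃ i, A i := Set.mem_iUnion.mpr ⟨i, hvi, hi⟩
      rw [Set.indicator_of_mem hm]
  refine hcov.trans ((lintegral_iUnion_le _ _).trans ?_)
  rw [tsum_fintype]
  have hone : ∀ i, ∫⁻ v in A i, Θ v ≤ (volume : Measure F) {x | ‖x‖ ≤ 1} ^ n *
      ∫⁻ a, Φ a * ‖a‖ₑ ^ n := by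
    intro i
    rw [← lintegral_indicator (hA i), lint_insert i]
    refine (lintegral_prod_le _).trans ?_
    rw [← lintegral_const_mul' _ _ (ENNReal.pow_lt_top (vol_ball_lt (F := F) 1)).ne]
    refine lintegral_mono fun a => ?_
    by_cases ha : a = 0
    · refine le_of_eq_of_le ?_ zero_le
      rw [lintegral_eq_zero_of_ae_eq_zero]
      refine Filter.Eventually.of_forall fun z => ?_
      apply Set.indicator_of_notMem
      intro h
      apply h.1
      simpa using ha
    · have : ∀ z : Fin n → F, (A i).indicator (fun v => Θ v) (i.insertNth a z) ≤
          Φ a * {z : Fin n → F | ∀ j, ‖z j‖ ≤ ‖a‖}.indicator 1 z := by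
        intro z
        by_cases h : i.insertNth a z ∈ A i
        · rw [Set.indicator_of_mem h]
          have hz : z ∈ {z : Fin n → F | ∀ j, ‖z j‖ ≤ ‖a‖} := by
            intro j
            simpa using h.2 (i.succAbove j)
          rw [Set.indicator_of_mem hz]
          simpa using hΘ _ i h.1 h.2
        · rw [Set.indicator_of_notMem h]; exact zero_le
      refine (lintegral_mono this).trans ?_
      rw [lintegral_const_mul _ (measurable_one.indicator (meas_ball_pi _)),
        lintegral_indicator_one (meas_ball_pi _), vol_ball_pi, vol_ball hF a ha, mul_pow]
      apply le_of_eq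
      ring
  refine (Finset.sum_le_sum fun i _ => hone i).trans ?_
  simp

/-- The integrand, in terms of the family `c` of columns of `h = cᵀ`. -/
noncomputable def gint (C s t : ℝ) (c : Fin n → Fin n → F) : ENNReal :=
  {c : Fin n → Fin n → F | Good C (of c)ᵀ}.indicator
    (fun c => ‖det (of c)‖ₑ ^ (s - n) * ‖fun i => emb (of c)ᵀ i 0‖ₑ ^ t) c

lemma gint_smul {C : ℝ} (hC : 0 ≤ C) (s t : ℝ) {k k' : Matrix (Fin n) (Fin n) F} (hk : KPair k k')
    (c : Fin n → Fin n → F) : gint C s t (fun j => k *ᵥ c j) = gint C s t c := by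
  have h1 : (of (fun j => k *ᵥ c j))ᵀ = k * (of c)ᵀ := by
    ext i j; rfl
  have h2 : det (of (fun j => k *ᵥ c j)) = k.det * det (of c) := by
    rw [← det_transpose, h1, det_mul, det_transpose]
  have h3 : (fun i => emb (of (fun j => k *ᵥ c j))ᵀ i 0) = emb k *ᵥ (fun i => emb (of c)ᵀ i 0) := by
    rw [h1, emb_mul]
    ext i; rfl
  unfold gint
  have h4 : (fun j => k *ᵥ c j) ∈ {c : Fin n → Fin n → F | Good C (of c)ᵀ} ↔
      c ∈ {c : Fin n → Fin n → F | Good C (of c)ᵀ} := by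
    show Good C (of (fun j => k *ᵥ c j))ᵀ ↔ _
    rw [h1, good_smul_iff hC hk]; rfl
  by_cases h : c ∈ {c : Fin n → Fin n → F | Good C (of c)ᵀ}
  · rw [Set.indicator_of_mem h, Set.indicator_of_mem (h4.mpr h), h2, h3, hk.emb.enorm, enorm_mul,
      hk.det, one_mul]
  · rw [Set.indicator_of_notMem h, Set.indicator_of_notMem (fun h' => h (h4.mp h'))]

end ints
end ZhangRTF

open Matrix MeasureTheory ZhangRTF

namespace ZhangRTF
set_option linter.unusedSectionVars false

section ints
variable {F : Type*} [NontriviallyNormedField F] [IsUltrametricDist F] [ProperSpace F]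
  [MeasureSpace F] [BorelSpace F] [(volume : Measure F).IsAddHaarMeasure] {n : ℕ}

instance sigmaFinite_pi1 {κ : Type*} [Fintype κ] : SigmaFinite (volume : Measure (κ → F)) :=
  inferInstance

instance sigmaFinite_pi2 {κ κ' : Type*} [Fintype κ] [Fintype κ'] :
    SigmaFinite (volume : Measure (κ → κ' → F)) :=
  Measure.pi.sigmaFinite _

lemma exists_row_iff {m : Type*} [Fintype m] [DecidableEq m] (E : Matrix m m F) (hE : E.det ≠ 0)
    (C : ℝ) (w : m → F) : (∃ q : m → F, (∀ i, ‖q i‖ ≤ C) ∧ q ᵥ* E = w) ↔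
      ∀ i, ‖(w ᵥ* adjugate E) i‖ ≤ C * ‖E.det‖ := by
  have hp : 0 < ‖E.det‖ := norm_pos_iff.mpr hE
  constructor
  · rintro ⟨q, hq, rfl⟩ i
    rw [vecMul_vecMul, mul_adjugate, vecMul_smul, vecMul_one, Pi.smul_apply, smul_eq_mul, norm_mul,
      mul_comm]
    exact mul_le_mul_of_nonneg_right (hq i) hp.le
  · intro h
    refine ⟨(E.det)⁻¹ • (w ᵥ* adjugate E), fun i => ?_, ?_⟩
    · rw [Pi.smul_apply, smul_eq_mul, norm_mul, norm_inv, inv_mul_le_iff₀ hp, mul_comm]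
      exact h i
    · rw [smul_vecMul, vecMul_vecMul, adjugate_mul, vecMul_smul, vecMul_one, smul_smul,
        inv_mul_cancel₀ hE, one_smul]

lemma good_iff (C : ℝ) (h : Matrix (Fin n) (Fin n) F) : Good C h ↔ h.det ≠ 0 ∧
    ∀ i j, ‖(emb h * (xiPlus n : Matrix (Fin (n + 1)) (Fin (n + 1)) F) * adjugate (emb h)) i j‖ ≤ C * ‖h.det‖ := by
  unfold Good
  refine and_congr_right fun hd => ?_
  have hE : (emb h).det ≠ 0 := by rwa [det_emb]
  have : ∀ i, (∃ q : Fin (n + 1) → F, (∀ j, ‖q j‖ ≤ C) ∧ q ᵥ* emb h = (emb h * (xiPlus n : Matrix (Fin (n + 1)) (Fin (n + 1)) F)) i) ↔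
      ∀ j, ‖(emb h * (xiPlus n : Matrix (Fin (n + 1)) (Fin (n + 1)) F) * adjugate (emb h)) i j‖ ≤ C * ‖h.det‖ := by
    intro i
    rw [exists_row_iff _ hE, det_emb]
    rfl
  simp_rw [← this]
  constructor
  · rintro ⟨X, hX, h1⟩ i
    exact ⟨X i, hX i, congrFun h1 i⟩
  · intro H
    choose q hq h1 using H
    exact ⟨of q, hq, funext h1⟩

lemma continuous_emb {α : Type*} [TopologicalSpace α] {f : α → Matrix (Fin n) (Fin n) F}
    (hf : Continuous f) : Continuous fun x => emb (f x) := by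
  refine continuous_matrix fun i j => ?_
  refine Fin.lastCases ?_ (fun i => ?_) i <;> refine Fin.lastCases ?_ (fun j => ?_) j <;>
    simp only [emb_cc, emb_cl, emb_lc, emb_ll]
  · exact continuous_const
  · exact continuous_const
  · exact continuous_const
  · exact hf.matrix_elem i j

lemma continuous_of {α : Type*} [TopologicalSpace α] {f : α → Fin n → Fin n → F}
    (hf : Continuous f) : Continuous fun x => (of (f x))ᵀ := by
  refine continuous_matrix fun i j => ?_
  exact (continuous_apply_apply j i).comp hf

/-- The set over which the recursion integrates. -/
def Tset (F : Type*) [NontriviallyNormedField F] (n : ℕ) (C : ℝ) :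
    Set ((Fin (n + 1) → F) × (Fin n → Fin n → F)) :=
  {p | Good C (of p.2)ᵀ ∧ ∃ q : Fin (n + 1) → F, (∀ i, ‖q i‖ ≤ C) ∧ q ᵥ* emb (of p.2)ᵀ = p.1}

lemma measurableSet_Tset (C : ℝ) : MeasurableSet (Tset F n C) := by
  have hM : Continuous fun p : (Fin (n + 1) → F) × (Fin n → Fin n → F) => (of p.2)ᵀ :=
    continuous_of continuous_snd
  have hE := continuous_emb hM
  have hd : Continuous fun p : (Fin (n + 1) → F) × (Fin n → Fin n → F) => det (of p.2)ᵀ :=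
    hM.matrix_det
  have : Tset F n C = {p | det (of p.2)ᵀ ≠ 0} ∩
    ({p | ∀ i j, ‖(emb (of p.2)ᵀ * (xiPlus n : Matrix (Fin (n + 1)) (Fin (n + 1)) F) * adjugate (emb (of p.2)ᵀ)) i j‖ ≤
        C * ‖det (of p.2)ᵀ‖} ∩
      {p | ∀ i, ‖(p.1 ᵥ* adjugate (emb (of p.2)ᵀ)) i‖ ≤ C * ‖det (of p.2)ᵀ‖}) := by
    ext p
    by_cases h : det (of p.2)ᵀ ≠ 0
    · have hE : (emb (of p.2)ᵀ).det ≠ 0 := by rwa [det_emb]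
      have h1 := exists_row_iff _ hE C p.1
      have h2 := good_iff C (of p.2)ᵀ
      rw [det_emb] at h1
      show (_ ∧ _) ↔ (_ ∧ _ ∧ _)
      rw [h1, h2, and_assoc]
      rfl
    · constructor
      · intro hp; exact absurd hp.1.1 h
      · intro hp; exact absurd hp.1 h
  rw [this]
  refine (isOpen_ne_fun hd continuous_const).measurableSet.inter (MeasurableSet.inter ?_ ?_)
  · simp only [Set.ofPred_forall]
    refine MeasurableSet.iInter fun i => MeasurableSet.iInter fun j => ?_
    refine (isClosed_le ?_ (continuous_const.mul hd.norm)).measurableSet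
    exact (((hE.matrix_mul continuous_const).matrix_mul hE.matrix_adjugate).matrix_elem i j).norm
  · simp only [Set.ofPred_forall]
    refine MeasurableSet.iInter fun i => ?_
    refine (isClosed_le ?_ (continuous_const.mul hd.norm)).measurableSet
    exact ((continuous_apply i).comp (continuous_fst.matrix_vecMul hE.matrix_adjugate)).norm

/-- The recursion integrand. -/
noncomputable def Bint (C s t : ℝ) (p : (Fin (n + 1) → F) × (Fin n → Fin n → F)) : ENNReal :=
  (Tset F n C).indicator (fun p => ‖p.1 0‖ₑ ^ t * ‖det (of p.2)‖ₑ ^ (s - (n + 1 : ℕ))) p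

lemma measurable_Bint (C s t : ℝ) : Measurable (Bint (F := F) (n := n) C s t) := by
  refine Measurable.indicator ?_ (measurableSet_Tset C)
  have hd : Continuous fun p : (Fin (n + 1) → F) × (Fin n → Fin n → F) => det (of p.2) := by
    have := (continuous_of (F := F) (n := n)
      (continuous_snd (X := Fin (n + 1) → F))).matrix_det
    simpa only [det_transpose] using this
  have h0 : Continuous fun p : (Fin (n + 1) → F) × (Fin n → Fin n → F) => p.1 0 :=
    (continuous_apply 0).comp continuous_fst
  exact (h0.measurable.enorm.pow_const _).mul (hd.measurable.enorm.pow_const _)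

/-- Pointwise bound for matrices whose first column is `a e₀`. -/
lemma gint_cons_le (C s t : ℝ) (a : F) (y : Fin n → F) (c : Fin n → Fin n → F) :
    gint C s t ((0 : Fin (n + 1)).insertNth (α := fun _ => Fin (n + 1) → F) (Pi.single 0 a : Fin (n + 1) → F)
      (fun j => (0 : Fin (n + 1)).insertNth (α := fun _ => F) (y j) (c j))) * ‖a‖ₑ ^ n ≤
    Bint C s (t + s - 1) ((0 : Fin (n + 1)).insertNth (α := fun _ => F) a y, c) := by
  set M : Fin (n + 1) → Fin (n + 1) → F :=
    (0 : Fin (n + 1)).insertNth (α := fun _ => Fin (n + 1) → F) (Pi.single 0 a : Fin (n + 1) → F)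
      (fun j => (0 : Fin (n + 1)).insertNth (α := fun _ => F) (y j) (c j)) with hM
  unfold gint
  by_cases h : M ∈ {c : Fin (n + 1) → Fin (n + 1) → F | Good C (of c)ᵀ}
  swap
  · rw [Set.indicator_of_notMem h, zero_mul]; exact zero_le
  rw [Set.indicator_of_mem h]
  have hcol : ∀ i : Fin n, (of M)ᵀ i.succ 0 = 0 := by
    intro i
    simp [hM]
  have h00 : (of M)ᵀ 0 0 = a := by simp [hM]
  have hsub : (of M)ᵀ.submatrix Fin.succ Fin.succ = (of c)ᵀ := by
    ext i j
    simp [hM]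
  have hrow : (of M)ᵀ 0 = (0 : Fin (n + 1)).insertNth (α := fun _ => F) a y := by
    ext j
    refine Fin.cases ?_ (fun j => ?_) j <;> simp [hM]
  have hg := good_succ hcol h
  rw [hsub, hrow] at hg
  have hdet : det (of M) = a * det (of c) := by
    rw [← det_transpose, det_col _ hcol, h00, hsub, det_transpose]
  have ha : a ≠ 0 := by
    have := h.1
    rw [det_transpose, hdet] at this
    exact left_ne_zero_of_mul this
  have hfc : ‖fun i => emb (of M)ᵀ i 0‖ₑ = ‖a‖ₑ := by
    have e0 : emb (of M)ᵀ 0 0 = a := by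
      have h2 := emb_cc (of M)ᵀ 0 0
      rw [h00] at h2
      exact h2
    rw [enorm_pi_eq _ 0, e0]
    intro j
    refine Fin.cases le_rfl (fun j => ?_) j
    rw [emb_s0 _ hcol]
    simp
  unfold Bint
  have hT : ((0 : Fin (n + 1)).insertNth (α := fun _ => F) a y, c) ∈ Tset F n C := hg
  rw [Set.indicator_of_mem hT, hfc, hdet, enorm_mul, ENNReal.mul_rpow_of_ne_top (by simp) (by simp)]
  have ha0 : ‖a‖ₑ ≠ 0 := by simpa using ha
  have hat : ‖a‖ₑ ≠ ⊤ := by simp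
  have e : t + s - 1 = (s - (n + 1 : ℕ)) + t + n := by push_cast; ring
  have h0 : ((0 : Fin (n + 1)).insertNth (α := fun _ => F) a y) 0 = a := by simp
  simp only [h0]
  rw [e, ENNReal.rpow_add _ _ ha0 hat, ENNReal.rpow_add _ _ ha0 hat, ENNReal.rpow_natCast]
  apply le_of_eq
  ring

lemma step (hF : Normalized F) {C : ℝ} (hC : 0 ≤ C) (s t : ℝ)
    (hc : cst F n C (t + s - 1) ≠ ⊤) :
    ∫⁻ c : Fin (n + 1) → Fin (n + 1) → F, gint C s t c ≤
      (n + 1 : ℕ) * ((volume : Measure F) {x | ‖x‖ ≤ 1} ^ n *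
        (cst F n C (t + s - 1) * ∫⁻ c : Fin n → Fin n → F, gint C s (t + s - 1) c)) := by
  let Θ : (Fin (n + 1) → F) → ENNReal := fun v => ∫⁻ R : Fin n → Fin (n + 1) → F,
    gint C s t ((0 : Fin (n + 1)).insertNth (α := fun _ => Fin (n + 1) → F) v R)
  have hΘ0 : Θ 0 = 0 := by
    simp only [Θ]
    rw [lintegral_eq_zero_of_ae_eq_zero]
    refine Filter.Eventually.of_forall fun R => ?_
    apply Set.indicator_of_notMem
    intro h
    apply h.1
    rw [det_transpose]
    exact det_eq_zero_of_row_eq_zero 0 (fun j => by simp)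
  have hΘK : ∀ (k k' : Matrix (Fin (n + 1)) (Fin (n + 1)) F) (v : Fin (n + 1) → F), KPair k k' →
      Θ (k *ᵥ v) = Θ v := by
    intro k k' v hk
    simp only [Θ]
    rw [← lintegral_mulVec_pi hF k k' hk.mul hk.mul', hk.det, one_pow, one_mul]
    refine lintegral_congr fun R => ?_
    rw [← gint_smul hC s t hk ((0 : Fin (n + 1)).insertNth (α := fun _ => Fin (n + 1) → F) v R)]
    congr 1
    ext j
    refine Fin.cases ?_ (fun j => ?_) j <;> simp
  have h1 := radial_le hF Θ (fun a => Θ (Pi.single 0 a)) hΘ0 (by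
    intro v i hvi hv
    obtain ⟨k, k', hk, h⟩ := exists_kpair v i hvi hv
    rw [← hΘK k k' v hk, h])
  have h2 : ∫⁻ c : Fin (n + 1) → Fin (n + 1) → F, gint C s t c ≤ ∫⁻ v, Θ v := by
    rw [lint_insert 0]
    exact lintegral_prod_le _
  refine h2.trans (h1.trans (mul_le_mul_right (mul_le_mul_right ?_ _) _))
  have hB := measurable_Bint (F := F) (n := n) C s (t + s - 1)
  calc ∫⁻ a, Θ (Pi.single 0 a) * ‖a‖ₑ ^ n
      ≤ ∫⁻ a : F, ∫⁻ y : Fin n → F, ∫⁻ c : Fin n → Fin n → F,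
          Bint C s (t + s - 1) ((0 : Fin (n + 1)).insertNth (α := fun _ => F) a y, c) := by
        refine lintegral_mono fun a => ?_
        simp only [Θ]
        rw [← lintegral_mul_const' _ _ (by simp), lint_insert_pi]
        refine (lintegral_prod_le _).trans ?_
        refine lintegral_mono fun y => lintegral_mono fun c => ?_
        exact gint_cons_le C s t a y c
    _ = ∫⁻ w : Fin (n + 1) → F, ∫⁻ c : Fin n → Fin n → F, Bint C s (t + s - 1) (w, c) := by
        rw [lint_insert 0]
        have hm : Measurable fun w : Fin (n + 1) → F => ∫⁻ c : Fin n → Fin n → F,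
          Bint C s (t + s - 1) (w, c) := hB.lintegral_prod_right'
        have he : Measurable fun p : F × (Fin n → F) =>
            (0 : Fin (n + 1)).insertNth (α := fun _ => F) p.1 p.2 :=
          (MeasurableEquiv.piFinSuccAbove (fun _ : Fin (n + 1) => F) 0).symm.measurable
        exact (lintegral_prod _ (hm.comp he).aemeasurable).symm
    _ = ∫⁻ c : Fin n → Fin n → F, ∫⁻ w : Fin (n + 1) → F, Bint C s (t + s - 1) (w, c) :=
        lintegral_lintegral_swap hB.aemeasurable
    _ ≤ ∫⁻ c : Fin n → Fin n → F, cst F n C (t + s - 1) * gint C s (t + s - 1) c := by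
        refine lintegral_mono fun c => ?_
        by_cases h : Good C (of c)ᵀ
        · have hc : c ∈ {c : Fin n → Fin n → F | Good C (of c)ᵀ} := h
          have hd : det (of c) ≠ 0 := by rw [← det_transpose]; exact h.1
          have hd0 : ‖det (of c)‖ₑ ≠ 0 := by simpa using hd
          have hdt : ‖det (of c)‖ₑ ≠ ⊤ := by simp
          have hE : (emb (of c)ᵀ).det ≠ 0 := by rw [det_emb]; exact h.1
          have hin := inner_le hF hC (t + s - 1) (emb (of c)ᵀ) hE
          have e : ∀ w, Bint C s (t + s - 1) (w, c) = ‖det (of c)‖ₑ ^ (s - (n + 1 : ℕ)) *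
            {w | ∃ q : Fin (n + 1) → F, (∀ i, ‖q i‖ ≤ C) ∧ q ᵥ* emb (of c)ᵀ = w}.indicator
              (fun w => ‖w 0‖ₑ ^ (t + s - 1)) w := by
            intro w
            unfold Bint
            by_cases hw : w ∈ {w | ∃ q : Fin (n + 1) → F, (∀ i, ‖q i‖ ≤ C) ∧ q ᵥ* emb (of c)ᵀ = w}
            · have hT : (w, c) ∈ Tset F n C := ⟨h, hw⟩
              rw [Set.indicator_of_mem hT, Set.indicator_of_mem hw, mul_comm]
            · have hT : (w, c) ∉ Tset F n C := fun h' => hw h'.2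
              rw [Set.indicator_of_notMem hT, Set.indicator_of_notMem hw, mul_zero]
          simp_rw [e]
          rw [lintegral_const_mul' _ _ (ENNReal.rpow_ne_top_of_ne_zero hd0 hdt)]
          refine (mul_le_mul_right hin _).trans ?_
          unfold gint
          rw [Set.indicator_of_mem hc, det_emb, det_transpose]
          have e2 : s - n = (s - (n + 1 : ℕ)) + (1 : ℝ) := by push_cast; ring
          rw [e2, ENNReal.rpow_add _ _ hd0 hdt, ENNReal.rpow_one]
          apply le_of_eq
          ring
        · refine le_of_eq_of_le ?_ zero_le
          rw [lintegral_eq_zero_of_ae_eq_zero]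
          refine Filter.Eventually.of_forall fun w => ?_
          apply Set.indicator_of_notMem
          intro h'
          exact h h'.1
    _ ≤ _ := ?_
  rw [lintegral_const_mul' _ _ hc]

end ints
end ZhangRTF

open Matrix MeasureTheory ZhangRTF

namespace ZhangRTF
set_option linter.unusedSectionVars false

section haar
variable {F : Type*} [NontriviallyNormedField F] [IsUltrametricDist F] [ProperSpace F]
  [MeasureSpace F] [BorelSpace F] [(volume : Measure F).IsAddHaarMeasure] {n : ℕ}

lemma J_lt (hF : Normalized F) {C : ℝ} (hC : 0 ≤ C) (s : ℝ) : ∀ (n : ℕ) (t : ℝ),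
    (∀ k : ℕ, k < n → -1 < t + (k + 1) * (s - 1)) →
    ∫⁻ c : Fin n → Fin n → F, gint C s t c < ⊤ := by
  intro n
  induction n with
  | zero =>
    intro t _
    have hb : ∀ c : Fin 0 → Fin 0 → F, gint C s t c ≤ 1 := by
      intro c
      unfold gint
      refine Set.indicator_le_self' (fun _ _ => zero_le) c |>.trans ?_
      have h1 : ‖fun i => emb (of c)ᵀ i 0‖ₑ = 1 := by
        rw [enorm_pi_eq _ 0]
        · have : emb (of c)ᵀ 0 0 = 1 := emb_ll (of c)ᵀ
          rw [this]; simp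
        · intro j
          rw [show j = 0 from Subsingleton.elim (α := Fin 1) j 0]
      rw [h1]
      simp
    refine lt_of_le_of_lt (lintegral_mono hb) ?_
    rw [lintegral_one, volume_pi, Measure.pi_univ]
    simp
  | succ n ih =>
    intro t ht
    have h0 : -1 < t + s - 1 := by
      have := ht 0 (Nat.succ_pos n)
      push_cast at this
      linarith
    have hc := cst_lt (n := n) hF C _ h0
    refine lt_of_le_of_lt (step hF hC s t hc.ne) ?_
    have hJ := ih (t + s - 1) (by
      intro k hk
      have := ht (k + 1) (Nat.succ_lt_succ hk)
      push_cast at this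
      linarith)
    refine ENNReal.mul_lt_top (by simp) (ENNReal.mul_lt_top ?_ (ENNReal.mul_lt_top hc hJ))
    exact ENNReal.pow_lt_top (vol_ball_lt 1)

/-- Columns of an invertible matrix. -/
def cols (h : GL (Fin n) F) : Fin n → Fin n → F := fun j i => (h : Matrix (Fin n) (Fin n) F) i j

lemma of_cols (h : GL (Fin n) F) : (of (cols h))ᵀ = (h : Matrix (Fin n) (Fin n) F) := rfl

lemma det_cols (h : GL (Fin n) F) : det (of (cols h)) = det (h : Matrix (Fin n) (Fin n) F) := by
  rw [← det_transpose, of_cols]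

lemma det_ne (h : GL (Fin n) F) : det (h : Matrix (Fin n) (Fin n) F) ≠ 0 :=
  ((Matrix.isUnit_iff_isUnit_det _).mp h.isUnit).ne_zero

lemma isOpenEmbedding_cols : Topology.IsOpenEmbedding (cols : GL (Fin n) F → _) := by
  have h1 : Topology.IsOpenEmbedding
      (Units.val : GL (Fin n) F → Matrix (Fin n) (Fin n) F) := by
    let i1 := Matrix.linftyOpNormedRing (n := Fin n) (α := F)
    have i2 : @CompleteSpace (Matrix (Fin n) (Fin n) F)
        i1.toPseudoMetricSpace.toUniformSpace :=
      inferInstanceAs (CompleteSpace (Fin n → Fin n → F))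
    have i3 : HasSummableGeomSeries (Matrix (Fin n) (Fin n) F) := inferInstance
    exact Units.isOpenEmbedding_val
  let e : Matrix (Fin n) (Fin n) F ≃ₜ (Fin n → Fin n → F) :=
    { toFun := fun M j i => M i j
      invFun := fun c => (of c)ᵀ
      left_inv := fun _ => rfl
      right_inv := fun _ => rfl
      continuous_toFun := by
        refine continuous_pi fun j => continuous_pi fun i => ?_
        exact continuous_id.matrix_elem i j
      continuous_invFun := continuous_of continuous_id }
  exact e.isOpenEmbedding.comp h1

instance lc_GL : LocallyCompactSpace (GL (Fin n) F) :=
  isOpenEmbedding_cols.locallyCompactSpace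

instance sc_GL : SecondCountableTopology (GL (Fin n) F) :=
  isOpenEmbedding_cols.isEmbedding.secondCountableTopology

/-- The density of the Haar measure. -/
noncomputable def dens (c : Fin n → Fin n → F) : ENNReal := ‖det (of c)‖ₑ ^ (-(n : ℝ))

lemma continuous_det_of : Continuous fun c : Fin n → Fin n → F => det (of c) := by
  have := (continuous_of (F := F) (n := n) continuous_id).matrix_det
  simpa only [det_transpose, id] using this

lemma measurable_dens : Measurable (dens : (Fin n → Fin n → F) → ENNReal) :=
  continuous_det_of.measurable.enorm.pow_const _

/-- An explicit Haar measure. -/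
noncomputable def nuGL (F : Type*) [NontriviallyNormedField F] [MeasureSpace F] (n : ℕ)
    [MeasurableSpace (GL (Fin n) F)] : Measure (GL (Fin n) F) :=
  Measure.comap cols (volume.withDensity dens)

variable [MeasurableSpace (GL (Fin n) F)] [BorelSpace (GL (Fin n) F)]

lemma me_cols : MeasurableEmbedding (cols : GL (Fin n) F → _) :=
  isOpenEmbedding_cols.measurableEmbedding

lemma nu_apply (A : Set (GL (Fin n) F)) (hA : MeasurableSet A) :
    nuGL F n A = ∫⁻ c : Fin n → Fin n → F, (cols '' A).indicator dens c := by
  unfold nuGL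
  have := me_cols.measurableSet_image.mpr hA
  rw [me_cols.comap_apply, withDensity_apply _ this, lintegral_indicator this]

lemma cols_mul (g h : GL (Fin n) F) : cols (g * h) =
    fun j => (g : Matrix (Fin n) (Fin n) F) *ᵥ cols h j := rfl

lemma nu_inv (hF : Normalized F) : (nuGL F n).IsMulLeftInvariant := by
  refine ⟨fun g => ?_⟩
  ext A hA
  have hm : Measurable fun h : GL (Fin n) F => g * h := (continuous_const_mul g).measurable
  rw [Measure.map_apply hm hA, nu_apply _ (hm hA), nu_apply _ hA]
  have h1 : (g : Matrix (Fin n) (Fin n) F) * ((g⁻¹ : GL (Fin n) F) : Matrix _ _ F) = 1 := by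
    rw [← Units.val_mul]; simp
  have h2 : ((g⁻¹ : GL (Fin n) F) : Matrix (Fin n) (Fin n) F) * (g : Matrix _ _ F) = 1 := by
    rw [← Units.val_mul]; simp
  rw [← lintegral_mulVec_pi hF _ _ h1 h2 ((cols '' A).indicator dens), Fintype.card_fin,
    ← lintegral_const_mul' _ _ (by simp)]
  refine lintegral_congr fun c => ?_
  have hg0 : ‖det (g : Matrix (Fin n) (Fin n) F)‖ₑ ≠ 0 := by simpa using det_ne g
  by_cases hc : c ∈ cols '' ((fun h => g * h) ⁻¹' A)
  · obtain ⟨h, hh, rfl⟩ := hc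
    have hc' : cols h ∈ cols '' ((fun h => g * h) ⁻¹' A) := ⟨h, hh, rfl⟩
    have hc2 : (fun j => (g : Matrix (Fin n) (Fin n) F) *ᵥ cols h j) ∈ cols '' A := ⟨g * h, hh, rfl⟩
    rw [Set.indicator_of_mem hc', Set.indicator_of_mem hc2, ← cols_mul]
    unfold dens
    rw [det_cols, det_cols, Units.val_mul, det_mul, enorm_mul,
      ENNReal.mul_rpow_of_ne_top (by simp) (by simp), ← mul_assoc, ← ENNReal.rpow_natCast,
      ← ENNReal.rpow_add _ _ hg0 (by simp)]
    simp
  · have hc2 : (fun j => (g : Matrix (Fin n) (Fin n) F) *ᵥ c j) ∉ cols '' A := by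
      rintro ⟨h, hh, he⟩
      apply hc
      refine ⟨g⁻¹ * h, by simpa using hh, ?_⟩
      rw [cols_mul, he]
      ext1 j
      simp only
      rw [mulVec_mulVec, h2, one_mulVec]
    rw [Set.indicator_of_notMem hc, Set.indicator_of_notMem hc2, mul_zero]

lemma nu_fin : IsFiniteMeasureOnCompacts (nuGL F n) := by
  refine ⟨fun K hK => ?_⟩
  rw [nu_apply _ hK.measurableSet]
  have hK' : IsCompact (cols '' K) := hK.image isOpenEmbedding_cols.continuous
  have hcont : ContinuousOn (fun c : Fin n → Fin n → F => ‖det (of c)‖⁻¹) (cols '' K) := by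
    refine ContinuousOn.inv₀ continuous_det_of.norm.continuousOn ?_
    rintro _ ⟨h, _, rfl⟩
    rw [det_cols]
    exact norm_ne_zero_iff.mpr (det_ne h)
  obtain ⟨B, hB⟩ := (hK'.image_of_continuousOn hcont).bddAbove
  have hle : ∀ c, (cols '' K).indicator dens c ≤
      (cols '' K).indicator (fun _ => ENNReal.ofReal B ^ (n : ℝ)) c := by
    intro c
    refine Set.indicator_le_indicator' fun hc => ?_
    have h1 := hB ⟨c, hc, rfl⟩
    unfold dens
    obtain ⟨h, _, rfl⟩ := hc
    have h0 : (det (of (cols h))) ≠ 0 := by rw [det_cols]; exact det_ne h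
    rw [ENNReal.rpow_neg, ← ENNReal.inv_rpow]
    refine ENNReal.rpow_le_rpow ?_ (by positivity)
    rw [← ofReal_norm, ← ENNReal.ofReal_inv_of_pos (norm_pos_iff.mpr h0)]
    exact ENNReal.ofReal_le_ofReal h1
  refine lt_of_le_of_lt (lintegral_mono hle) ?_
  rw [lintegral_indicator_const hK'.measurableSet]
  exact ENNReal.mul_lt_top (ENNReal.rpow_lt_top_of_nonneg (by positivity) (by simp))
    hK'.measure_lt_top

lemma nu_ne : nuGL F n ≠ 0 := by
  intro h
  have h1 := nu_apply (F := F) (n := n) Set.univ MeasurableSet.univ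
  rw [h, Measure.coe_zero, Pi.zero_apply, Set.image_univ] at h1
  have hR := isOpenEmbedding_cols (F := F) (n := n) |>.isOpen_range
  have hm : Measurable ((Set.range (cols : GL (Fin n) F → _)).indicator dens) :=
    measurable_dens.indicator hR.measurableSet
  rw [eq_comm, lintegral_eq_zero_iff hm] at h1
  have h2 : (volume : Measure (Fin n → Fin n → F)) (Set.range (cols : GL (Fin n) F → _)) = 0 := by
    refine measure_mono_null ?_ h1
    rintro _ ⟨g, rfl⟩ h3
    have h4 : (Set.range (cols : GL (Fin n) F → _)).indicator dens (cols g) = 0 := h3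
    rw [Set.indicator_of_mem (Set.mem_range_self g)] at h4
    unfold dens at h4
    rw [ENNReal.rpow_eq_zero_iff] at h4
    simp [det_cols, det_ne] at h4
  have i3 : (volume : Measure (Fin n → Fin n → F)).IsOpenPosMeasure :=
    Measure.pi.isOpenPosMeasure _
  have h5 := hR.measure_ne_zero (volume : Measure (Fin n → Fin n → F)) ⟨_, 1, rfl⟩
  exact h5 h2

lemma lintegral_haar_lt (hF : Normalized F) (μ : Measure (GL (Fin n) F)) [μ.IsHaarMeasure]
    (φ : (Fin n → Fin n → F) → ENNReal) (hφ : ∫⁻ c, dens c * φ c < ⊤) :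
    ∫⁻ h, φ (cols h) ∂μ < ⊤ := by
  have := nu_inv (n := n) hF
  have := nu_fin (F := F) (n := n)
  have h1 := Measure.isMulLeftInvariant_eq_smul (nuGL F n) μ
  set a := Measure.haarScalarFactor (nuGL F n) μ with ha
  have ha0 : a ≠ 0 := by
    intro h0
    rw [h0, zero_smul] at h1
    exact nu_ne h1
  have h2 : ∫⁻ h, φ (cols h) ∂(nuGL F n) < ⊤ := by
    rw [← me_cols.lintegral_map]
    unfold nuGL
    rw [me_cols.map_comap]
    refine lt_of_le_of_lt (lintegral_mono' Measure.restrict_le_self le_rfl) ?_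
    exact lt_of_le_of_lt (lintegral_withDensity_le_lintegral_mul _ measurable_dens _) hφ
  rw [h1, lintegral_smul_measure] at h2
  by_contra h3
  rw [not_lt, top_le_iff] at h3
  rw [h3] at h2
  simp [ENNReal.smul_def, ha0] at h2

end haar
end ZhangRTF

open Matrix MeasureTheory ZhangRTF

namespace ZhangRTF
set_option linter.unusedSectionVars false

section main
variable {F : Type*} [NontriviallyNormedField F] [IsUltrametricDist F] [ProperSpace F]
  [MeasureSpace F] [BorelSpace F] [(volume : Measure F).IsAddHaarMeasure] {n : ℕ}
  [MeasurableSpace (GL (Fin n) F)] [BorelSpace (GL (Fin n) F)]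

lemma continuous_act : Continuous fun h : GL (Fin n) F => act h (xiPlus n) := by
  unfold act
  exact ((continuous_emb Units.continuous_val).matrix_mul continuous_const).matrix_mul
    (continuous_emb (Units.continuous_val.comp continuous_inv))

lemma continuous_GLdet : Continuous fun h : GL (Fin n) F => GLdet h := by
  unfold GLdet
  exact Continuous.units_map (Matrix.detMonoidHom : Matrix (Fin n) (Fin n) F →* F)
    (continuous_id.matrix_det)

lemma good_of_act {C : ℝ} (h : GL (Fin n) F) (hb : ∀ i j, ‖act h (xiPlus n) i j‖ ≤ C) :
    Good C (h : Matrix (Fin n) (Fin n) F) := by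
  refine ⟨det_ne h, act h (xiPlus n), hb, ?_⟩
  unfold act
  rw [Matrix.mul_assoc, ← emb_mul, ← Units.val_mul, inv_mul_cancel, Units.val_one, emb_one,
    Matrix.mul_one]

theorem main_aux (hn : 1 ≤ n) (hF : Normalized F)
    (μ : Measure (GL (Fin n) F)) [μ.IsHaarMeasure]
    (η : Fˣ →* ℂˣ) (hη_cont : Continuous η) (hη_quad : ∀ x, η x * η x = 1)
    (f : Matrix (Fin (n + 1)) (Fin (n + 1)) F → ℂ)
    (hf_lc : IsLocallyConstant f) (hf_supp : HasCompactSupport f)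
    (s : ℂ) (hs : 1 - 1 / (n : ℝ) < s.re) :
    Integrable (fun h : GL (Fin n) F =>
      f (act h (xiPlus n)) * ((η (GLdet h) : ℂˣ) : ℂ) *
        Complex.exp (s * (Real.log ‖((h : Matrix (Fin n) (Fin n) F).det)‖ : ℂ))) μ := by
  have hdc : Continuous fun h : GL (Fin n) F => ‖(h : Matrix (Fin n) (Fin n) F).det‖ :=
    (Units.continuous_val.matrix_det).norm
  have hlog : Continuous fun h : GL (Fin n) F =>
      Real.log ‖(h : Matrix (Fin n) (Fin n) F).det‖ :=
    hdc.log fun h => norm_ne_zero_iff.mpr (det_ne h)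
  have hcont : Continuous (fun h : GL (Fin n) F =>
      f (act h (xiPlus n)) * ((η (GLdet h) : ℂˣ) : ℂ) *
        Complex.exp (s * (Real.log ‖((h : Matrix (Fin n) (Fin n) F).det)‖ : ℂ))) := by
    refine Continuous.mul (Continuous.mul (hf_lc.continuous.comp continuous_act) ?_) ?_
    · exact Units.continuous_val.comp (hη_cont.comp continuous_GLdet)
    · exact Complex.continuous_exp.comp
        (continuous_const.mul (Complex.continuous_ofReal.comp hlog))
  refine ⟨hcont.aestronglyMeasurable, ?_⟩
  -- bound for `f`
  obtain ⟨B, hB⟩ := hf_supp.exists_bound_of_continuous hf_lc.continuous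
  -- bound for the support
  have hsup : ∃ C : ℝ, 0 ≤ C ∧ ∀ X, f X ≠ 0 → ∀ i j, ‖X i j‖ ≤ C := by
    have h1 : ∀ i j, ∃ C : ℝ, ∀ X ∈ tsupport f, ‖X i j‖ ≤ C := by
      intro i j
      have hc : Continuous fun X : Matrix (Fin (n + 1)) (Fin (n + 1)) F => X i j :=
        continuous_id.matrix_elem i j
      exact hf_supp.isCompact.exists_bound_of_continuousOn hc.continuousOn
    choose D hD using h1
    refine ⟨∑ i, ∑ j, |D i j|, by positivity, fun X hX i j => ?_⟩
    have h2 := hD i j X (subset_tsupport f hX)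
    refine h2.trans ((le_abs_self _).trans ?_)
    refine le_trans ?_ (Finset.single_le_sum (f := fun i => ∑ j, |D i j|)
      (fun i _ => by positivity) (Finset.mem_univ i))
    exact Finset.single_le_sum (f := fun j => |D i j|)
      (fun j _ => by positivity) (Finset.mem_univ j)
  obtain ⟨C, hC, hfC⟩ := hsup
  have hη : ∀ x, ‖((η x : ℂˣ) : ℂ)‖ = 1 := by
    intro x
    have h1 := congrArg (fun u : ℂˣ => ‖(u : ℂ)‖) (hη_quad x)
    simp only [Units.val_mul, norm_mul, Units.val_one, norm_one] at h1
    nlinarith [norm_nonneg ((η x : ℂˣ) : ℂ)]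
  set φ : (Fin n → Fin n → F) → ENNReal := fun c => ENNReal.ofReal B *
    {c : Fin n → Fin n → F | Good C (of c)ᵀ}.indicator (fun c => ‖det (of c)‖ₑ ^ s.re) c with hφ
  have hfin : ∫⁻ h, φ (cols h) ∂μ < ⊤ := by
    apply lintegral_haar_lt hF
    have e : ∀ c, dens c * φ c = ENNReal.ofReal B * gint C s.re 0 c := by
      intro c
      simp only [hφ]
      unfold gint dens
      by_cases hc : c ∈ {c : Fin n → Fin n → F | Good C (of c)ᵀ}
      · rw [Set.indicator_of_mem hc, Set.indicator_of_mem hc]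
        have h0 : ‖det (of c)‖ₑ ≠ 0 := by
          have := hc.1
          rw [det_transpose] at this
          simpa using this
        rw [sub_eq_add_neg, ENNReal.rpow_add _ _ h0 (by simp), ENNReal.rpow_zero]
        ring
      · rw [Set.indicator_of_notMem hc, Set.indicator_of_notMem hc]
        simp
    simp_rw [e]
    rw [lintegral_const_mul' _ _ (by simp)]
    refine ENNReal.mul_lt_top (by simp) (J_lt hF hC s.re n 0 ?_)
    intro k hk
    have hn0 : (0 : ℝ) < n := by exact_mod_cast hn
    have hk1 : ((k : ℝ) + 1) ≤ n := by exact_mod_cast hk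
    have hk0 : (0 : ℝ) < (k : ℝ) + 1 := by positivity
    have h1 : -(1 / (n : ℝ)) < s.re - 1 := by linarith
    have h2 : ((k : ℝ) + 1) * (-(1 / (n : ℝ))) < ((k : ℝ) + 1) * (s.re - 1) :=
      mul_lt_mul_of_pos_left h1 hk0
    have h3 : ((k : ℝ) + 1) * (1 / (n : ℝ)) ≤ 1 := by
      rw [mul_one_div, div_le_one hn0]; exact hk1
    linarith
  refine lt_of_le_of_lt (lintegral_mono fun h => ?_) hfin
  by_cases hf0 : f (act h (xiPlus n)) = 0
  · simp [hf0]
  · have hg : cols h ∈ {c : Fin n → Fin n → F | Good C (of c)ᵀ} :=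
      good_of_act h (hfC _ hf0)
    simp only [hφ]
    rw [Set.indicator_of_mem hg, det_cols, enorm_mul, enorm_mul]
    have h1 : ‖f (act h (xiPlus n))‖ₑ ≤ ENNReal.ofReal B := by
      rw [← ofReal_norm]; exact ENNReal.ofReal_le_ofReal (hB _)
    have h2 : ‖((η (GLdet h) : ℂˣ) : ℂ)‖ₑ = 1 := by
      rw [← ofReal_norm, hη]; simp
    have hp : 0 < ‖(h : Matrix (Fin n) (Fin n) F).det‖ := norm_pos_iff.mpr (det_ne h)
    have h3 : ‖Complex.exp (s * (Real.log ‖((h : Matrix (Fin n) (Fin n) F).det)‖ : ℂ))‖ₑ =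
        ‖(h : Matrix (Fin n) (Fin n) F).det‖ₑ ^ s.re := by
      rw [← ofReal_norm, ← ofReal_norm, Complex.norm_exp, ENNReal.ofReal_rpow_of_pos hp,
        Real.rpow_def_of_pos hp]
      congr 2
      rw [Complex.re_mul_ofReal, mul_comm]
    rw [h2, h3, mul_one]
    exact mul_le_mul_left h1 _

end main
end ZhangRTF

open ZhangRTF

/-- Convergence of the regular nilpotent orbital integral `O(ξ₊, f, s)` for
`Re(s) > 1 - 1/n`. -/
theorem orbital_integral_converges    (n : ℕ) (hn : 1 ≤ n)
    (F : Type*) [NontriviallyNormedField F] [CompleteSpace F] [CharZero F]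
    [IsUltrametricDist F] [LocallyCompactSpace F]
    [MeasurableSpace F] [BorelSpace F]
    (μF : Measure F) [MeasureTheory.Measure.IsAddHaarMeasure μF]
    (hμF : ∀ a : F, a ≠ 0 → ∀ S : Set F,
      μF ((fun x => a * x) '' S) = ENNReal.ofReal ‖a‖ * μF S)
    [MeasurableSpace (Matrix.GeneralLinearGroup (Fin n) F)] [BorelSpace (Matrix.GeneralLinearGroup (Fin n) F)]
    (μ : Measure (Matrix.GeneralLinearGroup (Fin n) F)) [MeasureTheory.Measure.IsHaarMeasure μ]
    (η : Fˣ →* ℂˣ) (hη_cont : Continuous η) (hη_quad : ∀ x, η x * η x = 1)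
    (f : Matrix (Fin (n + 1)) (Fin (n + 1)) F → ℂ)
    (hf_lc : IsLocallyConstant f) (hf_supp : HasCompactSupport f)
    (s : ℂ) (hs : 1 - 1 / (n : ℝ) < s.re) :
    Integrable (fun h : Matrix.GeneralLinearGroup (Fin n) F =>
      f (act h (xiPlus n)) * ((η (GLdet h) : ℂˣ) : ℂ) *
        Complex.exp (s * (Real.log ‖((h : Matrix (Fin n) (Fin n) F).det)‖ : ℂ))) μ := by
  have i1 : ProperSpace F := ProperSpace.of_locallyCompactSpace F
  let i2 : MeasureSpace F := ⟨μF⟩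
  have i3 : (volume : Measure F).IsAddHaarMeasure := ‹μF.IsAddHaarMeasure›
  have i4 : @BorelSpace F _ i2.toMeasurableSpace := ‹BorelSpace F›
  exact main_aux (F := F) hn hμF μ η hη_cont hη_quad f hf_lc hf_supp s hs
end

section
/- (Proposition: the open nilpotent orbit) An element X ∈ M_{n+1}(F) satisfies X ∈ 𝒩 and Δ_+(X) ≠ 0 if and only if X = h·ξ_+ for some h ∈ GL_n(F); that is, M_{n+1,+} ∩ 𝒩 is exactly the GL_n(F)-orbit of ξ_+. -/
open Matrix MeasureTheory

open ZhangRTF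

lemma emb_mul_apply_aux {F : Type*} [Field F] {n : ℕ} (h : Matrix (Fin n) (Fin n) F) :
    (∀ i j : Fin n, emb h i.castSucc j.castSucc = h i j) ∧
    (∀ i : Fin n, emb h i.castSucc (Fin.last n) = 0) ∧
    (∀ j : Fin n, emb h (Fin.last n) j.castSucc = 0) ∧
    emb h (Fin.last n) (Fin.last n) = 1 := by
  refine ⟨?_, ?_, ?_, ?_⟩ <;> intros <;> simp [emb]

lemma emb_mul_emb {F : Type*} [Field F] {n : ℕ} (h g : Matrix (Fin n) (Fin n) F) :
    emb h * emb g = emb (h * g) := by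
  obtain ⟨h1, h2, h3, h4⟩ := emb_mul_apply_aux h
  obtain ⟨g1, g2, g3, g4⟩ := emb_mul_apply_aux g
  obtain ⟨k1, k2, k3, k4⟩ := emb_mul_apply_aux (h * g)
  ext i j
  refine Fin.lastCases ?_ (fun i => ?_) i <;> refine Fin.lastCases ?_ (fun j => ?_) j <;>
    simp only [Matrix.mul_apply, Fin.sum_univ_castSucc, *] <;> simp

lemma emb_one_eq {F : Type*} [Field F] {n : ℕ} :
    emb (1 : Matrix (Fin n) (Fin n) F) = 1 := by
  obtain ⟨h1, h2, h3, h4⟩ := emb_mul_apply_aux (1 : Matrix (Fin n) (Fin n) F)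
  ext i j
  refine Fin.lastCases ?_ (fun i => ?_) i <;> refine Fin.lastCases ?_ (fun j => ?_) j <;>
    simp only [*] <;> simp [Matrix.one_apply, Fin.ext_iff]
  · intro hh; have := j.2; omega
  · intro hh; have := i.2; omega

lemma act_eq_iff_comm {F : Type*} [Field F] {n : ℕ} (h : Matrix.GeneralLinearGroup (Fin n) F)
    (Y X : Matrix (Fin (n + 1)) (Fin (n + 1)) F) :
    act h Y = X ↔ emb (h : Matrix (Fin n) (Fin n) F) * Y
      = X * emb (h : Matrix (Fin n) (Fin n) F) := by
  have e1 : emb (h : Matrix (Fin n) (Fin n) F) *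
    emb ((h⁻¹ : Matrix.GeneralLinearGroup (Fin n) F) : Matrix (Fin n) (Fin n) F) = 1 := by
    rw [emb_mul_emb, ← Units.val_mul, mul_inv_cancel, Units.val_one, emb_one_eq]
  have e2 : emb ((h⁻¹ : Matrix.GeneralLinearGroup (Fin n) F) : Matrix (Fin n) (Fin n) F) *
    emb (h : Matrix (Fin n) (Fin n) F) = 1 := by
    rw [emb_mul_emb, ← Units.val_mul, inv_mul_cancel, Units.val_one, emb_one_eq]
  unfold act
  constructor
  · rintro rfl
    rw [Matrix.mul_assoc, e2, Matrix.mul_one]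
  · intro hh
    rw [hh, Matrix.mul_assoc, e1, Matrix.mul_one]

lemma act_xi_iff {F : Type*} [Field F] {n : ℕ} (h : Matrix.GeneralLinearGroup (Fin n) F)
    (X : Matrix (Fin (n + 1)) (Fin (n + 1)) F) :
    act h (xiPlus n) = X ↔
      (h : Matrix (Fin n) (Fin n) F) * blockA (xiPlus n) = blockA X * (h : Matrix (Fin n) (Fin n) F) ∧
      (h : Matrix (Fin n) (Fin n) F) *ᵥ blockU (xiPlus n) = blockU X ∧
      blockV X ᵥ* (h : Matrix (Fin n) (Fin n) F) = 0 ∧ blockW X = 0 := by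
  rw [act_eq_iff_comm]
  obtain ⟨h1, h2, h3, h4⟩ := emb_mul_apply_aux (h : Matrix (Fin n) (Fin n) F)
  have hx1 : ∀ j : Fin n, (xiPlus n : Matrix _ _ F) (Fin.last n) j.castSucc = 0 := by
    intro j
    have := j.2
    simp only [xiPlus, Matrix.of_apply, Fin.val_castSucc, Fin.val_last]
    rw [if_neg (by omega)]
  have hx2 : (xiPlus n : Matrix _ _ F) (Fin.last n) (Fin.last n) = 0 := by
    simp [xiPlus]
  rw [← Matrix.ext_iff]
  simp only [Fin.forall_fin_succ', Matrix.mul_apply, Fin.sum_univ_castSucc, h1, h2, h3, h4, hx1, hx2,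
    ← Matrix.ext_iff, funext_iff, blockA, blockU, blockV, blockW, Matrix.mulVec, Matrix.vecMul,
    dotProduct, Matrix.of_apply, Pi.zero_apply]
  simp only [mul_zero, zero_mul, add_zero, zero_add, mul_one, one_mul, Finset.sum_const_zero,
    forall_and, and_assoc, @eq_comm F 0]

lemma pow_col {F : Type*} [Field F] {n : ℕ} (A h : Matrix (Fin n) (Fin n) F) (u : Fin n → F)
    (hA : h * blockA (xiPlus n) = A * h) (hu : h *ᵥ blockU (xiPlus n) = u) :
    ∀ k (hk : k < n), A ^ k *ᵥ u = fun i => h i ⟨n - 1 - k, by omega⟩ := by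
  intro k
  induction k with
  | zero =>
    intro hk
    rw [pow_zero, Matrix.one_mulVec, ← hu]
    ext i
    simp only [Matrix.mulVec, dotProduct, blockU, xiPlus, Matrix.of_apply]
    rw [Finset.sum_eq_single ⟨n - 1 - 0, by omega⟩]
    · simp; intro hh; omega
    · intro b _ hb
      rw [if_neg, mul_zero]
      intro hh
      simp at hh
      exact hb (Fin.ext (by simp; omega))
    · simp
  | succ k ih =>
    intro hk
    rw [pow_succ', ← Matrix.mulVec_mulVec, ih (by omega)]
    ext i
    have := congrFun (congrFun hA i) ⟨n - 1 - k, by omega⟩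
    rw [Matrix.mul_apply, Matrix.mul_apply] at this
    simp only [Matrix.mulVec, dotProduct]
    rw [← this]
    simp only [blockA, xiPlus, Matrix.of_apply]
    rw [Finset.sum_eq_single ⟨n - 1 - (k + 1), by omega⟩]
    · simp; intro hh; omega
    · intro b _ hb
      rw [if_neg, mul_zero]
      intro hh
      simp at hh
      exact hb (Fin.ext (by simp; omega))
    · simp

lemma charpoly_xi {F : Type*} [Field F] {n : ℕ} :
    (blockA (xiPlus n : Matrix _ _ F)).charpoly = Polynomial.X ^ n := by
  rw [Matrix.charpoly_of_isUpperTriangular]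
  · simp [blockA, xiPlus]
  · intro i j hij
    have : (j : ℕ) < i := hij
    simp only [blockA, xiPlus, Matrix.of_apply, Fin.val_castSucc]
    rw [if_neg (by omega)]

lemma charpoly_of_aInv {F : Type*} [Field F] {n : ℕ} (X : Matrix (Fin (n + 1)) (Fin (n + 1)) F)
    (hX : aInv X = 0) : (blockA X).charpoly = Polynomial.X ^ n := by
  have hd : (blockA X).charpoly.natDegree = n := by
    simp [Matrix.charpoly_natDegree_eq_dim]
  have hm := (blockA X).charpoly_monic
  ext k
  rw [Polynomial.coeff_X_pow]
  rcases lt_trichotomy k n with hk | hk | hk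
  · rw [if_neg hk.ne]
    have := congrFun hX ⟨n - 1 - k, by omega⟩
    simp only [aInv, Pi.zero_apply, neg_eq_zero] at this
    rwa [show n - 1 - (n - 1 - k) = k by omega] at this
  · subst hk
    rw [if_pos rfl]
    have := hm.coeff_natDegree
    rwa [hd] at this
  · rw [if_neg hk.ne']
    exact Polynomial.coeff_eq_zero_of_natDegree_lt (by omega)

/-- `M_{n+1,+} ∩ 𝒩` is exactly the `GL_n(F)`-orbit of `ξ₊`. -/
theorem open_nilpotent_orbit (n : ℕ) (hn : 1 ≤ n) (F : Type*) [Field F]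
    (X : Matrix (Fin (n + 1)) (Fin (n + 1)) F) :
    (invMap X = 0 ∧ DeltaPlus X ≠ 0) ↔
      ∃ h : Matrix.GeneralLinearGroup (Fin n) F, act h (xiPlus n) = X := by
  constructor
  · rintro ⟨hX, hD⟩
    have ha : aInv X = 0 := congrArg Prod.fst hX
    have hb : bInv X = 0 := congrArg Prod.snd hX
    have hcp := charpoly_of_aInv X ha
    have hnil : blockA X ^ n = 0 := by
      have := Matrix.aeval_self_charpoly (blockA X)
      rwa [hcp, map_pow, Polynomial.aeval_X] at this
    refine ⟨Matrix.GeneralLinearGroup.mkOfDetNeZero (deltaPlus X) hD, ?_⟩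
    rw [act_xi_iff]
    change deltaPlus X * _ = _ * deltaPlus X ∧ deltaPlus X *ᵥ _ = _ ∧ _ ᵥ* deltaPlus X = 0 ∧ _
    refine ⟨?_, ?_, ?_, ?_⟩
    · ext i j
      have hR : (blockA X * deltaPlus X) i j
          = (blockA X ^ (n - 1 - (j : ℕ) + 1) *ᵥ blockU X) i := by
        rw [pow_succ', ← Matrix.mulVec_mulVec]
        rfl
      rw [hR, Matrix.mul_apply]
      have hj := j.2
      by_cases hj0 : (j : ℕ) = 0
      · rw [show n - 1 - (j : ℕ) + 1 = n by omega, hnil, Matrix.zero_mulVec]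
        apply Finset.sum_eq_zero
        intro k _
        simp [blockA, xiPlus, hj0]
      · rw [Finset.sum_eq_single ⟨j - 1, by omega⟩]
        · simp only [deltaPlus, blockA, xiPlus, Matrix.of_apply, Fin.val_castSucc]
          rw [if_pos (by omega), mul_one,
            show n - 1 - ((j : ℕ) - 1) = n - 1 - (j : ℕ) + 1 by omega]
        · intro b _ hb
          simp only [blockA, xiPlus, Matrix.of_apply, Fin.val_castSucc]
          rw [if_neg, mul_zero]
          intro hh
          exact hb (Fin.ext (by simp; omega))
        · simp
    · ext i
      simp only [Matrix.mulVec, dotProduct]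
      rw [Finset.sum_eq_single ⟨n - 1, by omega⟩]
      · simp only [deltaPlus, blockU, xiPlus, Matrix.of_apply, Fin.val_castSucc, Fin.val_last]
        rw [if_pos (by omega), mul_one]
        simp [blockU]
      · intro b _ hb
        simp only [blockU, xiPlus, Matrix.of_apply, Fin.val_castSucc, Fin.val_last]
        rw [if_neg, mul_zero]
        intro hh
        exact hb (Fin.ext (by simp; omega))
      · simp
    · ext j
      have hj := j.2
      have := congrFun hb ⟨n - 1 - (j : ℕ) + 1, by omega⟩
      simp only [bInv, Pi.zero_apply] at this
      rw [if_neg (by omega), Nat.add_sub_cancel] at this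
      exact this
    · have := congrFun hb 0
      simpa [bInv] using this
  · rintro ⟨h, hh⟩
    rw [act_xi_iff] at hh
    obtain ⟨h1, h2, h3, h4⟩ := hh
    have hv : blockV X = 0 := by
      have := congrArg (fun z => z ᵥ* ((h⁻¹ : Matrix.GeneralLinearGroup (Fin n) F) :
        Matrix (Fin n) (Fin n) F)) h3
      simp only [Matrix.vecMul_vecMul, Matrix.zero_vecMul] at this
      rwa [← Units.val_mul, mul_inv_cancel, Units.val_one, Matrix.vecMul_one] at this
    have hA : blockA X = (h : Matrix (Fin n) (Fin n) F) * blockA (xiPlus n) *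
        ((h⁻¹ : Matrix.GeneralLinearGroup (Fin n) F) : Matrix (Fin n) (Fin n) F) := by
      rw [h1, Matrix.mul_assoc, ← Units.val_mul, mul_inv_cancel, Units.val_one, Matrix.mul_one]
    have hc : (blockA X).charpoly = Polynomial.X ^ n := by
      rw [hA, ← charpoly_xi (F := F), Matrix.coe_units_inv]
      exact Matrix.charpoly_units_conj h _
    have hd : deltaPlus X = h := by
      ext i j
      have hj := j.2
      have := congrFun (pow_col _ _ _ h1 h2 (n - 1 - (j : ℕ)) (by omega)) i
      simp only [deltaPlus, Matrix.of_apply]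
      rw [this]
      exact congrArg ((h : Matrix (Fin n) (Fin n) F) i) (Fin.ext (show n - 1 - (n - 1 - (j : ℕ)) = j by omega))
    refine ⟨Prod.ext ?_ ?_, ?_⟩
    · ext i
      have hi := i.2
      simp only [invMap, aInv, hc, Polynomial.coeff_X_pow]
      rw [if_neg (by omega)]
      simp
    · ext i
      simp [invMap, bInv, hv, h4]
    · rw [DeltaPlus, hd]
      exact ((Matrix.isUnit_iff_isUnit_det _).1 h.isUnit).ne_zero
end

section
/- (σ is a regular section of the invariants map) For every (a,b) ∈ F^n × F^{n+1}: π(σ(a,b)) = (a,b) and δ_+(σ(a,b)) = 1_n (the identity matrix); in particular Δ_+(σ(a,b)) = 1, so σ(a,b) ∈ M_{n+1,+}. -/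
open Matrix MeasureTheory

open ZhangRTF

theorem sig_pow {n : ℕ} {F : Type*} [Field F] (a : Fin n → F) (b : Fin (n + 1) → F)
    (k : ℕ) (hk : k < n) :
    blockA (sectSigma a b) ^ k *ᵥ blockU (sectSigma a b) =
      Pi.single (⟨n - 1 - k, by omega⟩ : Fin n) (1 : F) := by
  induction k with
  | zero =>
    funext i
    have := i.2
    simp only [pow_zero, one_mulVec, blockU, sectSigma, Matrix.of_apply, Pi.single_apply,
      Fin.ext_iff, Fin.val_castSucc, Fin.val_last, Fin.is_lt, dite_true]
    rw [if_neg (by omega), zero_add]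
    exact if_congr (by omega) rfl rfl
  | succ k ih =>
    rw [pow_succ', ← mulVec_mulVec, ih (by omega), mulVec_single_one]
    funext i
    have := i.2
    simp only [Matrix.col_apply, blockA, sectSigma, Matrix.of_apply, Pi.single_apply,
      Fin.ext_iff, Fin.val_castSucc, Fin.is_lt, dite_true]
    rw [if_neg (by omega), zero_add]
    exact if_congr (by omega) rfl rfl

theorem sig_pow_n {n : ℕ} (hn : 1 ≤ n) {F : Type*} [Field F] (a : Fin n → F)
    (b : Fin (n + 1) → F) :
    blockA (sectSigma a b) ^ n *ᵥ blockU (sectSigma a b) = a := by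
  obtain ⟨m, rfl⟩ : ∃ m, n = m + 1 := ⟨n - 1, by omega⟩
  rw [pow_succ', ← mulVec_mulVec, sig_pow a b m (by omega), mulVec_single_one]
  funext i
  simp [Matrix.col_apply, blockA, sectSigma]
  intro h
  exact absurd i.2 (by omega)

theorem sig_aInv {n : ℕ} (hn : 1 ≤ n) {F : Type*} [Field F] (a : Fin n → F)
    (b : Fin (n + 1) → F) : aInv (sectSigma a b) = a := by
  funext i
  have hi := i.2
  have h := Matrix.aeval_self_charpoly (blockA (sectSigma a b))
  have hd : (blockA (sectSigma a b)).charpoly.natDegree = n := by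
    simp [Matrix.charpoly_natDegree_eq_dim]
  have hm : (blockA (sectSigma a b)).charpoly.coeff n = 1 := by
    have := (Matrix.charpoly_monic (blockA (sectSigma a b))).coeff_natDegree
    rwa [hd] at this
  rw [Polynomial.aeval_eq_sum_range, hd, Finset.sum_range_succ, hm, one_smul] at h
  have h2 := congrFun (congrArg (fun M => M *ᵥ blockU (sectSigma a b)) h) i
  simp only [add_mulVec, sum_mulVec, smul_mulVec, sig_pow_n hn, zero_mulVec, Pi.add_apply,
    Finset.sum_apply, Pi.smul_apply, Pi.zero_apply] at h2
  rw [Finset.sum_eq_single (n - 1 - (i : ℕ))] at h2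
  · rw [sig_pow a b _ (by omega), Pi.single_apply, if_pos (by ext; simp; omega)] at h2
    simp only [aInv]
    rw [smul_eq_mul, mul_one] at h2
    linear_combination -h2
  · intro k hk hne
    have hk := Finset.mem_range.1 hk
    rw [sig_pow a b _ hk, Pi.single_apply, if_neg (by rw [Fin.ext_iff]; simp; omega), smul_zero]
  · intro h
    exact absurd (Finset.mem_range.2 (by omega)) h

theorem sig_bInv {n : ℕ} {F : Type*} [Field F] (a : Fin n → F)
    (b : Fin (n + 1) → F) : bInv (sectSigma a b) = b := by
  funext j
  have hj := j.2
  unfold bInv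
  split_ifs with h
  · have : j = 0 := Fin.ext h
    subst this
    simp [blockW, sectSigma]
  · rw [sig_pow a b _ (by omega), dotProduct_single_one]
    simp only [blockV, sectSigma, Matrix.of_apply, Fin.val_last, lt_irrefl, dite_false]
    congr 1
    ext
    simp [Fin.val_rev]
    omega

theorem sig_delta {n : ℕ} {F : Type*} [Field F] (a : Fin n → F)
    (b : Fin (n + 1) → F) : deltaPlus (sectSigma a b) = 1 := by
  ext i j
  have hj := j.2
  simp only [deltaPlus, Matrix.of_apply]
  rw [sig_pow a b _ (by omega), Pi.single_apply, Matrix.one_apply]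
  refine if_congr ?_ rfl rfl
  rw [Fin.ext_iff, Fin.ext_iff]
  simp
  omega

/-- `σ` is a regular section of the invariants map: `π(σ(a,b)) = (a,b)` and
`δ₊(σ(a,b)) = 1`, so `Δ₊(σ(a,b)) = 1`. -/
theorem sigma_regular_section (n : ℕ) (hn : 1 ≤ n) (F : Type*) [Field F]
    (a : Fin n → F) (b : Fin (n + 1) → F) :
    invMap (sectSigma a b) = (a, b) ∧ deltaPlus (sectSigma a b) = 1 ∧
      DeltaPlus (sectSigma a b) = 1 := by
  exact ⟨Prod.ext (sig_aInv hn a b) (sig_bInv a b), sig_delta a b, by rw [DeltaPlus, sig_delta, det_one]⟩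
end
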